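/- arXiv:2106.07422 — 2 statements merged into one kernel-verified Lean document; each statement's English description precedes it below -/
import Mathlib

section
/- For every t > 0 there exist C > 0 and s₀ > 0 such that G_E(s) ≤ C·s^{−9/8} for all s ≥ s₀. Consequently, G_M(s) + G_E(s) = C_𝒫·s⁻¹ + O(s^{−9/8}) as s → ∞, where C_𝒫 = 2304(2−√2)/π⁸. -/
open MeasureTheory Matrix Set Pointwise

noncomputable section

/-- The real embedding of `ℤ[√2]`, `a + b√2 ↦ a + b√2`. -/
def emb (α : Zsqrtd 2) : ℝ := (α.re : ℝ) + (α.im : ℝ) * Real.sqrt 2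

/-- The Galois-conjugate embedding `σ`, `a + b√2 ↦ a − b√2`. -/
def embc (α : Zsqrtd 2) : ℝ := (α.re : ℝ) - (α.im : ℝ) * Real.sqrt 2

/-- The fundamental unit `λ = 1 + √2`. -/
def lam : ℝ := 1 + Real.sqrt 2

/-- `𝓛'`: the Minkowski embedding of `ℤ[√2]` in `ℝ²`. -/
def Lp : Set (ℝ × ℝ) := {p | ∃ α : Zsqrtd 2, p = (emb α, embc α)}

/-- `v(β₁,β₂) = (β₁, β₂, σ(β₁), σ(β₂))`. -/
def latvec (β₁ β₂ : Zsqrtd 2) : Fin 4 → ℝ := ![emb β₁, emb β₂, embc β₁, embc β₂]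

/-- `𝓛`: the Minkowski embedding of `ℤ[√2]²` in `ℝ⁴`. -/
def Lquad : Set (Fin 4 → ℝ) := {v | ∃ β₁ β₂ : Zsqrtd 2, v = latvec β₁ β₂}

/-- `𝓛h`, for a 4×4 real matrix `h` (row vectors, right multiplication). -/
def latimage (h : Matrix (Fin 4) (Fin 4) ℝ) : Set (Fin 4 → ℝ) :=
  (fun v => Matrix.vecMul v h) '' Lquad

def nmat (x : ℝ) : Matrix (Fin 2) (Fin 2) ℝ := !![1, x; 0, 1]
def amat (y : ℝ) : Matrix (Fin 2) (Fin 2) ℝ := !![y, 0; 0, y⁻¹]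
def kmat (θ : ℝ) : Matrix (Fin 2) (Fin 2) ℝ :=
  !![Real.cos θ, -Real.sin θ; Real.sin θ, Real.cos θ]

/-- Block diagonal 4×4 matrix from two 2×2 blocks. -/
def bd (A B : Matrix (Fin 2) (Fin 2) ℝ) : Matrix (Fin 4) (Fin 4) ℝ :=
  !![A 0 0, A 0 1, 0, 0;
     A 1 0, A 1 1, 0, 0;
     0, 0, B 0 0, B 0 1;
     0, 0, B 1 0, B 1 1]

/-- `h(x₁,x₂,y₁,y₂,θ₁,θ₂) = diag(n(x₁)a(y₁)k(θ₁), n(x₂)a(y₂)k(θ₂))`. -/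
def hmat (x₁ x₂ y₁ y₂ θ₁ θ₂ : ℝ) : Matrix (Fin 4) (Fin 4) ℝ :=
  bd (nmat x₁ * amat y₁ * kmat θ₁) (nmat x₂ * amat y₂ * kmat θ₂)

/-- `H = SL₂(ℝ)² ⊂ SL₄(ℝ)` (block diagonal). -/
def Hset : Set (Matrix (Fin 4) (Fin 4) ℝ) :=
  {h | ∃ A B : Matrix (Fin 2) (Fin 2) ℝ, A.det = 1 ∧ B.det = 1 ∧ h = bd A B}

/-- `Γ_K = {diag(A, σ(A)) : A ∈ SL₂(ℤ[√2])}`. -/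
def GammaK : Set (Matrix (Fin 4) (Fin 4) ℝ) :=
  {g | ∃ A : Matrix (Fin 2) (Fin 2) (Zsqrtd 2), A.det = 1 ∧ g = bd (A.map emb) (A.map embc)}

/-- `𝒲`: the open regular octagon of side length √2. -/
def Woct : Set (ℝ × ℝ) :=
  {p | |p.1| < lam / Real.sqrt 2 ∧ |p.2| < lam / Real.sqrt 2 ∧ |p.1| + |p.2| < lam}

/-- `𝒲' = 𝒲 ∖ (√2−1)𝒲`. -/
def Wp : Set (ℝ × ℝ) := Woct \ ((Real.sqrt 2 - 1) • Woct)

/-- `θ̂ = 48√2/π⁴`, the density of visible points. -/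
def thetaHat : ℝ := 48 * Real.sqrt 2 / Real.pi ^ 4

/-- `T(s)`: open triangle with vertices `(0,0)`, `(s/θ̂)^{1/2}(1,±1)`. -/
def Tset (s : ℝ) : Set (ℝ × ℝ) :=
  {p | 0 < p.1 ∧ p.1 < Real.sqrt (s / thetaHat) ∧ |p.2| < p.1}

/-- `𝔉`: a fundamental domain of `𝓛'`. -/
def Fdom : Set (ℝ × ℝ) :=
  {p | ∃ r₁ ∈ Set.Ico (0:ℝ) 1, ∃ r₂ ∈ Set.Ico (0:ℝ) 1,
    p = (1 + r₁ + r₂ * Real.sqrt 2, 2 + r₁ - r₂ * Real.sqrt 2)}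

/-- The Siegel domain `𝔇_t`. -/
def Dset (t : ℝ) : Set (Matrix (Fin 4) (Fin 4) ℝ) :=
  {h | ∃ x₁ x₂ y₁ y₂ θ₁ θ₂ : ℝ, (x₁, x₂) ∈ Fdom ∧ 0 < y₁ ∧ 0 < y₂ ∧ t ≤ y₁ * y₂ ∧
    lam ^ (-2 : ℤ) ≤ y₁ / y₂ ∧ y₁ / y₂ ≤ lam ^ 2 ∧
    θ₁ ∈ Set.Ico 0 Real.pi ∧ θ₂ ∈ Set.Ico 0 Real.pi ∧ h = hmat x₁ x₂ y₁ y₂ θ₁ θ₂}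

/-- Row vector times 2×2 matrix, on `ℝ × ℝ`. -/
def mul2 (p : ℝ × ℝ) (M : Matrix (Fin 2) (Fin 2) ℝ) : ℝ × ℝ :=
  (p.1 * M 0 0 + p.2 * M 1 0, p.1 * M 0 1 + p.2 * M 1 1)

/-- `r(s)`: the unique integer with `λ^{2r} ≤ s^{1/4} < λ^{2(r+1)}`. -/
def rr (s : ℝ) : ℤ := ⌊Real.logb (lam ^ 2) (s ^ ((1:ℝ)/4))⌋

/-- `𝒯(s)` with explicit integer `r`: `λ^{−2r}T(s) × λ^{2r}𝒲`. -/
def calT (s : ℝ) (r : ℤ) : Set (Fin 4 → ℝ) :=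
  {v | (lam ^ (2*r) * v 0, lam ^ (2*r) * v 1) ∈ Tset s ∧
       (lam ^ (-(2*r)) * v 2, lam ^ (-(2*r)) * v 3) ∈ Woct}

/-- `𝒯(s) = λ^{−2r(s)}T(s) × λ^{2r(s)}𝒲`. -/
def calTs (s : ℝ) : Set (Fin 4 → ℝ) := calT s (rr s)

/-- Euclidean norm on `ℝ⁴`. -/
def enorm4 (v : Fin 4 → ℝ) : ℝ := Real.sqrt (∑ i, (v i) ^ 2)

/-- `𝓛h̃ = (ℤ(y₁,0,y₂,0) + ℤ√2(y₁,0,−y₂,0) + ℝ(0,1,0,0) + ℝ(0,0,0,1))·diag(k(θ₁),k(θ₂))`. -/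
def Ltilde (y₁ y₂ θ₁ θ₂ : ℝ) : Set (Fin 4 → ℝ) :=
  {v | ∃ (m n : ℤ) (c₁ c₂ : ℝ),
    v = Matrix.vecMul ![((m:ℝ) + (n:ℝ) * Real.sqrt 2) * y₁, c₁,
          ((m:ℝ) - (n:ℝ) * Real.sqrt 2) * y₂, c₂] (bd (kmat θ₁) (kmat θ₂))}

open Classical in
/-- Real-valued indicator of a proposition. -/
def ind (P : Prop) : ℝ := if P then 1 else 0

/-- `c_H = 3/π⁴`. -/
def cH : ℝ := 3 / Real.pi ^ 4

/-- `Y_t = {(y₁,y₂) : y₁,y₂ > 0, y₁y₂ ≥ t, y₁/y₂ ∈ (λ⁻²,λ²)}`. -/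
def Yt (t : ℝ) : Set (ℝ × ℝ) :=
  {y | 0 < y.1 ∧ 0 < y.2 ∧ t ≤ y.1 * y.2 ∧ lam ^ (-2:ℤ) < y.1 / y.2 ∧ y.1 / y.2 < lam ^ 2}

/-- The main term `G_M(s)` (depending on the Siegel-domain parameter `t`). -/
def GM (t s : ℝ) : ℝ :=
  cH * ∫ θ₂ in Set.Ico (0:ℝ) Real.pi, ∫ θ₁ in Set.Ico (0:ℝ) Real.pi, ∫ y in Yt t, ∫ x in Fdom,
    (y.1 ^ 3 * y.2 ^ 3)⁻¹ * ind (Ltilde y.1 y.2 θ₁ θ₂ ∩ calTs s = ∅)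

/-- The error term `G_E(s)`. -/
def GE (t s : ℝ) : ℝ :=
  cH * ∫ θ₂ in Set.Ico (0:ℝ) Real.pi, ∫ θ₁ in Set.Ico (0:ℝ) Real.pi, ∫ y in Yt t, ∫ x in Fdom,
    (y.1 ^ 3 * y.2 ^ 3)⁻¹ *
      ind (latimage (hmat x.1 x.2 y.1 y.2 θ₁ θ₂) ∩ calTs s = ∅ ∧
           (Ltilde y.1 y.2 θ₁ θ₂ ∩ calTs s).Nonempty)

/-- `J = [0,π/4] ∪ [3π/4,π)`. -/
def Jset : Set ℝ := Set.Icc 0 (Real.pi/4) ∪ Set.Ico (3*Real.pi/4) Real.pi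

/-- `Y = {(y₁,y₂) : y₁ > 0, 1 < y₂ < λ²}`. -/
def Yset : Set (ℝ × ℝ) := {y | 0 < y.1 ∧ 1 < y.2 ∧ y.2 < lam ^ 2}

/-- `T₁`: open triangle with vertices `(0,0)`, `(1,±1)`. -/
def T1 : Set (ℝ × ℝ) := {p | 0 < p.1 ∧ p.1 < 1 ∧ |p.2| < p.1}

/-- `ℓ₁(θ₁)`: first-coordinate projection of `θ̂^{−1/2}T₁k(−θ₁)`. -/
def ell1 (θ₁ : ℝ) : Set ℝ :=
  {x | ∃ p ∈ T1, x = (mul2 ((Real.sqrt thetaHat)⁻¹ • p) (kmat (-θ₁))).1}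

/-- `ℓ₂(θ₂)`: first-coordinate projection of `𝒲k(−θ₂)`. -/
def ell2 (θ₂ : ℝ) : Set ℝ := {x | ∃ p ∈ Woct, x = (mul2 p (kmat (-θ₂))).1}

/-- `C_𝒫 = 2304(2−√2)/π⁸`. -/
def CP : ℝ := 2304 * (2 - Real.sqrt 2) / Real.pi ^ 8

/-- `ζ_K(2) = π⁴/(48√2)`. -/
def zetaK2 : ℝ := Real.pi ^ 4 / (48 * Real.sqrt 2)

/-- `𝒯'(s) = T(s) × 𝒲`. -/
def Tprime (s : ℝ) : Set (Fin 4 → ℝ) :=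
  {v | (v 0, v 1) ∈ Tset s ∧ (v 2, v 3) ∈ Woct}

/-- `L₁(θ₁)` from Lemma 3.4: projection of `λ^{−2r}T(s)k(−θ₁)` onto the x-axis. -/
def L1set (s : ℝ) (r : ℤ) (θ₁ : ℝ) : Set ℝ :=
  {x | ∃ p ∈ Tset s, x = (mul2 ((lam ^ (-(2*r)) : ℝ) • p) (kmat (-θ₁))).1}

/-- `L₂(θ₂)`: projection of `λ^{2r}𝒲k(−θ₂)` onto the x-axis. -/
def L2set (r : ℤ) (θ₂ : ℝ) : Set ℝ :=
  {x | ∃ p ∈ Woct, x = (mul2 ((lam ^ (2*r) : ℝ) • p) (kmat (-θ₂))).1}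

/-- `n(x)a(y)k(θ)` where `y,θ` are determined by `y⁻¹(sin θ, cos θ) = z`. -/
def hz (z : ℝ × ℝ) (x : ℝ) : Matrix (Fin 2) (Fin 2) ℝ :=
  nmat x * amat (Real.sqrt (z.1 ^ 2 + z.2 ^ 2))⁻¹ *
    !![(Real.sqrt (z.1 ^ 2 + z.2 ^ 2))⁻¹ * z.2, -((Real.sqrt (z.1 ^ 2 + z.2 ^ 2))⁻¹ * z.1);
       (Real.sqrt (z.1 ^ 2 + z.2 ^ 2))⁻¹ * z.1, (Real.sqrt (z.1 ^ 2 + z.2 ^ 2))⁻¹ * z.2]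

/-- The function `F₂` of Lemma 4.7. -/
def F2 (z₁ : ℝ) : ℝ :=
  (24 / Real.pi ^ 4) * ∫ z₂ in Set.Ioo (-z₁) z₁, ∫ w in Wp, ∫ x in Fdom,
    ind (latimage (bd (hz (z₁, z₂) x.1) (hz w x.2)) ∩ Tprime (z₁ ^ 2 * thetaHat) = ∅)

/-- The box `B(α₃,α₄)`. -/
def Bbox (α₃ α₄ : Zsqrtd 2) (C₁ s : ℝ) : Set (ℝ × ℝ) :=
  {x | |x.1 + emb α₄ / emb α₃| ≤ C₁ / Real.sqrt s ∧
       |x.2 + embc α₄ / embc α₃| ≤ C₁ / Real.sqrt s}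

/-- The matrix `h` determined by `s, z₂, w, x₁, x₂` via
`y₁⁻¹(sin θ₁, cos θ₁) = λ^{−2r}(θ̂^{−1/2}s^{1/2}, z₂)`, `y₂⁻¹(sin θ₂, cos θ₂) = λ^{2r}w`. -/
def hfull (s z₂ : ℝ) (w : ℝ × ℝ) (x₁ x₂ : ℝ) : Matrix (Fin 4) (Fin 4) ℝ :=
  bd (hz ((lam ^ (-(2 * rr s)) : ℝ) • (Real.sqrt (s / thetaHat), z₂)) x₁)
     (hz ((lam ^ (2 * rr s) : ℝ) • w) x₂)

/-- `F⁺_{(α₃,α₄)}(s)`. -/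
def Fplus (α₃ α₄ : Zsqrtd 2) (C₁ s : ℝ) : ℝ :=
  (Real.sqrt s)⁻¹ * ∫ z₂ in Set.Ioo (0:ℝ) (Real.sqrt (s / thetaHat)), ∫ w in Wp,
    ∫ x in Bbox α₃ α₄ C₁ s, ind (latimage (hfull s z₂ w x.1 x.2) ∩ calTs s = ∅)

/-- `F⁻_{(α₃,α₄)}(s)`. -/
def Fminus (α₃ α₄ : Zsqrtd 2) (C₁ s : ℝ) : ℝ :=
  (Real.sqrt s)⁻¹ * ∫ z₂ in Set.Ioo (-Real.sqrt (s / thetaHat)) (0:ℝ), ∫ w in Wp,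
    ∫ x in Bbox α₃ α₄ C₁ s, ind (latimage (hfull s z₂ w x.1 x.2) ∩ calTs s = ∅)

/-- `F_{(α₃,α₄)}(s)`. -/
def Ffull (α₃ α₄ : Zsqrtd 2) (C₁ s : ℝ) : ℝ :=
  (Real.sqrt s)⁻¹ *
    ∫ z₂ in Set.Ioo (-Real.sqrt (s / thetaHat)) (Real.sqrt (s / thetaHat)), ∫ w in Wp,
      ∫ x in Bbox α₃ α₄ C₁ s, ind (latimage (hfull s z₂ w x.1 x.2) ∩ calTs s = ∅)

/-- `v₁ = (α₃, α₄, σ(α₃), σ(α₄))`. -/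
def vv1 (α₃ α₄ : Zsqrtd 2) : Fin 4 → ℝ := ![emb α₃, emb α₄, embc α₃, embc α₄]

/-- `v₂ = (√2α₃, √2α₄, −√2σ(α₃), −√2σ(α₄))`. -/
def vv2 (α₃ α₄ : Zsqrtd 2) : Fin 4 → ℝ :=
  ![Real.sqrt 2 * emb α₃, Real.sqrt 2 * emb α₄,
    -(Real.sqrt 2 * embc α₃), -(Real.sqrt 2 * embc α₄)]

/-- `b₁ = (α₃, α₄, 0, 0)`. -/
def bb1 (α₃ α₄ : Zsqrtd 2) : Fin 4 → ℝ := ![emb α₃, emb α₄, 0, 0]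

/-- `b₂ = (0, 0, σ(α₃), σ(α₄))`. -/
def bb2 (α₃ α₄ : Zsqrtd 2) : Fin 4 → ℝ := ![0, 0, embc α₃, embc α₄]

/-- The subgrid `𝓛_v = v + ℤv₁ + ℤv₂`. -/
def Lv (α₃ α₄ : Zsqrtd 2) (v : Fin 4 → ℝ) : Set (Fin 4 → ℝ) :=
  {u | ∃ m n : ℤ, u = v + (m:ℝ) • vv1 α₃ α₄ + (n:ℝ) • vv2 α₃ α₄}

/-- The filled plane `Π_v = v + ℝb₁ + ℝb₂`. -/
def Piv (α₃ α₄ : Zsqrtd 2) (v : Fin 4 → ℝ) : Set (Fin 4 → ℝ) :=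
  {u | ∃ c₁ c₂ : ℝ, u = v + c₁ • bb1 α₃ α₄ + c₂ • bb2 α₃ α₄}

/-- `d(s) = θ̂^{−1/2}λ^{−2r}s^{1/2}`. -/
def ds (s : ℝ) : ℝ := lam ^ (-(2 * rr s)) * Real.sqrt (s / thetaHat)

/-- The explicit integral representation `Φ(s)` of the limiting gap distribution `F(s)`. -/
def Phi (s : ℝ) : ℝ :=
  (1 / ((2:ℝ) ^ ((11:ℝ)/2) * Real.sqrt thetaHat * zetaK2 * Real.sqrt s)) *
    ∫ z₂ in Set.Ioo (-Real.sqrt (s / thetaHat)) (Real.sqrt (s / thetaHat)), ∫ w in Wp,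
      ∫ x in Fdom, ind (latimage (hfull s z₂ w x.1 x.2) ∩ calTs s = ∅)

lemma sqrt_two_bounds : (1.4142:ℝ) < Real.sqrt 2 ∧ Real.sqrt 2 < 1.4143 :=
  ⟨Real.lt_sqrt_of_sq_lt (by norm_num), (Real.sqrt_lt' (by norm_num)).2 (by norm_num)⟩

lemma sqrt_two_sq : Real.sqrt 2 * Real.sqrt 2 = 2 := Real.mul_self_sqrt (by norm_num)

lemma lam_pos : 0 < lam := by unfold lam; positivity

lemma lam_bounds : (2.4142:ℝ) < lam ∧ lam < 2.4143 := by
  have := sqrt_two_bounds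
  unfold lam; constructor <;> linarith [this.1, this.2]

lemma one_lt_lam : 1 < lam := by linarith [lam_bounds.1]

lemma lam_sq : lam ^ 2 = 2 * lam + 1 := by
  unfold lam; nlinarith [sqrt_two_sq]

lemma emb_mul (α β : Zsqrtd 2) : emb (α * β) = emb α * emb β := by
  simp only [emb, Zsqrtd.re_mul, Zsqrtd.im_mul]; push_cast
  linear_combination (-(α.im * β.im : ℝ)) * sqrt_two_sq

lemma embc_mul (α β : Zsqrtd 2) : embc (α * β) = embc α * embc β := by
  simp only [embc, Zsqrtd.re_mul, Zsqrtd.im_mul]; push_cast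
  linear_combination (-(α.im * β.im : ℝ)) * sqrt_two_sq

lemma emb_neg (α : Zsqrtd 2) : emb (-α) = -emb α := by
  simp [emb]; ring

lemma embc_neg (α : Zsqrtd 2) : embc (-α) = -embc α := by
  simp [embc]; ring

lemma emb_zero : emb 0 = 0 := by simp [emb]

lemma embc_zero : embc 0 = 0 := by simp [embc]

/-- The powers of the fundamental unit. -/
lemma exists_unit (k : ℤ) : ∃ (u : Zsqrtd 2) (ε : ℝ), (ε = 1 ∨ ε = -1) ∧
    emb u = lam ^ k ∧ embc u = ε * lam ^ (-k) := by
  have key : ∀ n : ℕ, (∃ (u : Zsqrtd 2) (ε : ℝ), (ε = 1 ∨ ε = -1) ∧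
      emb u = lam ^ (n:ℤ) ∧ embc u = ε * lam ^ (-(n:ℤ))) ∧
      (∃ (u : Zsqrtd 2) (ε : ℝ), (ε = 1 ∨ ε = -1) ∧
      emb u = lam ^ (-(n:ℤ)) ∧ embc u = ε * lam ^ (n:ℤ)) := by
    have hl := lam_pos.ne'
    have h1 : emb ⟨1, 1⟩ = lam := by simp [emb, lam]
    have h2 : embc ⟨1, 1⟩ = -lam⁻¹ := by
      rw [eq_neg_iff_add_eq_zero]; field_simp
      simp only [embc, lam]; push_cast; linarith [sqrt_two_sq]
    have h3 : emb ⟨-1, 1⟩ = lam⁻¹ := by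
      apply eq_inv_of_mul_eq_one_left
      simp only [emb, lam]; push_cast; linarith [sqrt_two_sq]
    have h4 : embc ⟨-1, 1⟩ = -lam := by simp [embc, lam]; ring
    intro n
    induction n with
    | zero => exact ⟨⟨1, 1, by simp [emb, embc]⟩, ⟨1, 1, by simp [emb, embc]⟩⟩
    | succ n ih =>
      obtain ⟨⟨u, ε, hε, hu, hu'⟩, ⟨v, δ, hδ, hv, hv'⟩⟩ := ih
      refine ⟨⟨u * ⟨1, 1⟩, -ε, ?_, ?_, ?_⟩, ⟨v * ⟨-1, 1⟩, -δ, ?_, ?_, ?_⟩⟩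
      · rcases hε with rfl | rfl <;> simp
      · rw [emb_mul, hu, h1]; push_cast; rw [zpow_add₀ hl, zpow_one]
      · rw [embc_mul, hu', h2]; push_cast; rw [neg_add, zpow_add₀ hl, _root_.zpow_neg_one]; ring
      · rcases hδ with rfl | rfl <;> simp
      · rw [emb_mul, hv, h3]; push_cast; rw [neg_add, zpow_add₀ hl, _root_.zpow_neg_one]
      · rw [embc_mul, hv', h4]; push_cast; rw [zpow_add₀ hl, zpow_one]; ring
  obtain ⟨n, rfl | rfl⟩ := k.eq_nat_or_neg
  · exact (key n).1
  · simpa using (key n).2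

/-- Every positive real lies in a half-open interval between consecutive powers of `lam`. -/
lemma exists_lam_zpow {x : ℝ} (hx : 0 < x) : ∃ k : ℤ, lam ^ k ≤ x ∧ x < lam ^ (k + 1) :=
  exists_mem_Ico_zpow hx one_lt_lam

lemma exists_lam_zpow' {x : ℝ} (hx : 0 < x) : ∃ k : ℤ, lam ^ k < x ∧ x ≤ lam ^ (k + 1) :=
  exists_mem_Ioc_zpow hx one_lt_lam

/-- Boxes of large area contain points of the Minkowski embedding of `ℤ[√2]`. -/
lemma exists_lattice_point {ρ₁ ρ₂ : ℝ} (p q : ℝ) (h₁ : 0 < ρ₁) (h : 9 ≤ ρ₁ * ρ₂) :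
    ∃ β : Zsqrtd 2, |emb β - p| < ρ₁ ∧ |embc β - q| < ρ₂ := by
  have square : ∀ p q : ℝ, ∃ β : Zsqrtd 2, |emb β - p| < 3/2 ∧ |embc β - q| < 3/2 := by
    intro p q
    refine ⟨⟨round ((p + q) / 2), round ((p - q) / (2 * Real.sqrt 2))⟩, ?_⟩
    have a := abs_sub_round ((p + q) / 2)
    have b := abs_sub_round ((p - q) / (2 * Real.sqrt 2))
    set m := round ((p + q) / 2)
    set n := round ((p - q) / (2 * Real.sqrt 2))
    have h2 := sqrt_two_bounds
    have b' : |(p - q) / 2 - n * Real.sqrt 2| ≤ 0.71 := by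
      have : (p - q) / 2 - n * Real.sqrt 2 =
          ((p - q) / (2 * Real.sqrt 2) - n) * Real.sqrt 2 := by
        field_simp
      rw [this, abs_mul, abs_of_pos (by linarith : 0 < Real.sqrt 2)]
      nlinarith [abs_nonneg ((p - q) / (2 * Real.sqrt 2) - n)]
    rw [abs_le] at a b'
    simp only [emb, embc, abs_lt]
    refine ⟨⟨?_, ?_⟩, ⟨?_, ?_⟩⟩ <;> linarith [a.1, a.2, b'.1, b'.2]
  obtain ⟨k, hk, hk'⟩ := exists_lam_zpow (x := ρ₁ * (2/3)) (by positivity)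
  obtain ⟨u, ε, hε, hu, hu'⟩ := exists_unit k
  have hε2 : ε * ε = 1 := by rcases hε with rfl | rfl <;> norm_num
  have hεa : |ε| = 1 := by rcases hε with rfl | rfl <;> norm_num
  have hkp : 0 < lam ^ k := zpow_pos lam_pos k
  obtain ⟨γ, hγ, hγ'⟩ := square (p / lam ^ k) (ε * q * lam ^ k)
  refine ⟨u * γ, ?_, ?_⟩
  · rw [emb_mul, hu]
    have : lam ^ k * emb γ - p = lam ^ k * (emb γ - p / lam ^ k) := by field_simp
    rw [this, abs_mul, abs_of_pos hkp]
    nlinarith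
  · rw [embc_mul, hu', _root_.zpow_neg]
    have : ε * (lam ^ k)⁻¹ * embc γ - q = ε * (lam ^ k)⁻¹ * (embc γ - ε * q * lam ^ k) := by
      field_simp; linear_combination (lam ^ k * q) * hε2
    rw [this, abs_mul, abs_mul, hεa, abs_of_pos (inv_pos.2 hkp), one_mul,
      inv_mul_lt_iff₀ hkp]
    rw [zpow_add₀ lam_pos.ne', zpow_one] at hk'
    have := lam_bounds.2
    have hρ₂ : 0 < ρ₂ := by
      by_contra! hh
      nlinarith
    have : ρ₁ * ρ₂ * (2/3) ≤ lam ^ k * ρ₂ * lam := by nlinarith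
    have : 0 < lam ^ k * ρ₂ := by positivity
    nlinarith

/-- A box around the origin that contains a nonzero algebraic integer contains a unit. -/
lemma exists_unit_of_exists {α : Zsqrtd 2} {A B : ℝ} (h0 : emb α ≠ 0) (hA : |emb α| < A)
    (hB : |embc α| < B) : ∃ k : ℤ, lam ^ k < A ∧ lam ^ (-k) < B := by
  have hApos : 0 < A := (abs_nonneg _).trans_lt hA
  obtain ⟨k, hk, hk'⟩ := exists_lam_zpow' hApos
  refine ⟨k, hk, ?_⟩
  by_contra! hB'
  obtain ⟨u, ε, hε, hu, hu'⟩ := exists_unit (-k)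
  have hεa : |ε| = 1 := by rcases hε with rfl | rfl <;> norm_num
  have hkp : 0 < lam ^ k := zpow_pos lam_pos k
  have h1 : |emb (u * α)| < lam := by
    rw [emb_mul, hu, abs_mul, _root_.zpow_neg, abs_of_pos (inv_pos.2 hkp), inv_mul_lt_iff₀ hkp]
    rw [zpow_add₀ lam_pos.ne', zpow_one] at hk'
    linarith
  have h2 : |embc (u * α)| < 1 := by
    rw [embc_mul, hu', abs_mul, abs_mul, hεa, neg_neg, abs_of_pos hkp, one_mul]
    rw [_root_.zpow_neg] at hB'
    calc lam ^ k * |embc α| < lam ^ k * (lam ^ k)⁻¹ := by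
          apply mul_lt_mul_of_pos_left _ hkp; linarith
      _ = 1 := mul_inv_cancel₀ hkp.ne'
  have h3 : emb (u * α) ≠ 0 := by
    rw [emb_mul, hu]; exact mul_ne_zero (zpow_pos lam_pos _).ne' h0
  generalize u * α = γ at h1 h2 h3
  obtain ⟨a, b⟩ := γ
  have hb := sqrt_two_bounds
  simp only [emb, embc, lam] at h1 h2 h3
  rw [abs_lt] at h1 h2
  have ha1 : a < 2 := by
    have : (a:ℝ) < 2 := by linarith
    exact_mod_cast this
  have ha2 : -2 < a := by
    have : (-2:ℝ) < a := by linarith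
    exact_mod_cast this
  have hb1 : b < 2 := by
    have : (b:ℝ) < 2 := by nlinarith
    exact_mod_cast this
  have hb2 : -2 < b := by
    have : (-2:ℝ) < b := by nlinarith
    exact_mod_cast this
  obtain ⟨h1, h1'⟩ := h1
  obtain ⟨h2, h2'⟩ := h2
  interval_cases a <;> interval_cases b <;> push_cast at h1 h2 h3 h1' h2' <;>
    first | linarith | simp at h3

/-- The point `(u, v)k(θ)` lies in the open triangle with vertices `(0,0)`, `R(1,±1)`. -/
def InTri (R θ u v : ℝ) : Prop :=
  u * Real.cos θ + v * Real.sin θ < R ∧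
    |v * Real.cos θ - u * Real.sin θ| < u * Real.cos θ + v * Real.sin θ

/-- The point `(u, v)k(θ)` lies in the octagon. -/
def InOct (θ u v : ℝ) : Prop :=
  (u * Real.cos θ + v * Real.sin θ, v * Real.cos θ - u * Real.sin θ) ∈ Woct

/-- The support function of the octagon. -/
def octSupp (θ : ℝ) : ℝ :=
  max ((lam * |Real.cos θ| + |Real.sin θ|) / Real.sqrt 2)
    ((|Real.cos θ| + lam * |Real.sin θ|) / Real.sqrt 2)

/-- The width `|cos θ| + sin θ` of the unit triangle. -/
def triSupp (θ : ℝ) : ℝ := |Real.cos θ| + Real.sin θ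

lemma mem_calTs_iff {s v₀ v₁ v₂ v₃ θ₁ θ₂ : ℝ} :
    (Matrix.vecMul ![v₀, v₁, v₂, v₃] (bd (kmat θ₁) (kmat θ₂))) ∈ calTs s ↔
      InTri (Real.sqrt (s / thetaHat)) θ₁ (lam ^ (2 * rr s) * v₀) (lam ^ (2 * rr s) * v₁) ∧
      InOct θ₂ (v₂ / lam ^ (2 * rr s)) (v₃ / lam ^ (2 * rr s)) := by
  have e0 : lam ^ (2 * rr s) * v₀ * Real.cos θ₁ + lam ^ (2 * rr s) * v₁ * Real.sin θ₁ =
      lam ^ (2 * rr s) * (v₀ * Real.cos θ₁ + v₁ * Real.sin θ₁) := by ring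
  have e1 : lam ^ (2 * rr s) * v₁ * Real.cos θ₁ - lam ^ (2 * rr s) * v₀ * Real.sin θ₁ =
      lam ^ (2 * rr s) * (-(v₀ * Real.sin θ₁) + v₁ * Real.cos θ₁) := by ring
  have e2 : v₂ / lam ^ (2 * rr s) * Real.cos θ₂ + v₃ / lam ^ (2 * rr s) * Real.sin θ₂ =
      lam ^ (-(2 * rr s)) * (v₂ * Real.cos θ₂ + v₃ * Real.sin θ₂) := by
    rw [_root_.zpow_neg]; ring
  have e3 : v₃ / lam ^ (2 * rr s) * Real.cos θ₂ - v₂ / lam ^ (2 * rr s) * Real.sin θ₂ =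
      lam ^ (-(2 * rr s)) * (-(v₂ * Real.sin θ₂) + v₃ * Real.cos θ₂) := by
    rw [_root_.zpow_neg]; ring
  simp only [calTs, calT, InTri, InOct, Tset, e0, e1, e2, e3]
  simp [bd, kmat]
  intro _ _ h
  refine lt_of_le_of_lt ?_ h
  positivity

lemma latimage_inter_eq_empty_iff {s x₁ x₂ y₁ y₂ θ₁ θ₂ : ℝ} :
    latimage (hmat x₁ x₂ y₁ y₂ θ₁ θ₂) ∩ calTs s = ∅ ↔
      ∀ β₁ β₂ : Zsqrtd 2,
      ¬ (InTri (Real.sqrt (s / thetaHat)) θ₁ (lam ^ (2 * rr s) * (emb β₁ * y₁))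
        (lam ^ (2 * rr s) * ((emb β₁ * x₁ + emb β₂) / y₁)) ∧
      InOct θ₂ (embc β₁ * y₂ / lam ^ (2 * rr s))
        ((embc β₁ * x₂ + embc β₂) / y₂ / lam ^ (2 * rr s))) := by
  have key : ∀ β₁ β₂ : Zsqrtd 2,
      Matrix.vecMul (latvec β₁ β₂) (hmat x₁ x₂ y₁ y₂ θ₁ θ₂) =
      Matrix.vecMul ![emb β₁ * y₁, (emb β₁ * x₁ + emb β₂) / y₁, embc β₁ * y₂,
        (embc β₁ * x₂ + embc β₂) / y₂] (bd (kmat θ₁) (kmat θ₂)) := by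
    intro β₁ β₂
    ext i
    fin_cases i <;>
      simp [latvec, hmat, bd, kmat, nmat, amat, Matrix.vecMul, dotProduct,
        Fin.sum_univ_four, Matrix.mul_apply] <;> ring
  simp only [← mem_calTs_iff, ← key, Set.eq_empty_iff_forall_notMem]
  constructor
  · intro h β₁ β₂ h'
    exact h _ ⟨⟨_, ⟨β₁, β₂, rfl⟩, rfl⟩, h'⟩
  · rintro h _ ⟨⟨_, ⟨β₁, β₂, rfl⟩, rfl⟩, h'⟩
    exact h β₁ β₂ h'

lemma Ltilde_inter_nonempty_iff {s y₁ y₂ θ₁ θ₂ : ℝ} :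
    (Ltilde y₁ y₂ θ₁ θ₂ ∩ calTs s).Nonempty ↔
      ∃ α : Zsqrtd 2, (∃ v, InTri (Real.sqrt (s / thetaHat)) θ₁
        (lam ^ (2 * rr s) * (emb α * y₁)) v) ∧
      ∃ v, InOct θ₂ (embc α * y₂ / lam ^ (2 * rr s)) v := by
  have hμ : lam ^ (2 * rr s) ≠ 0 := (zpow_pos lam_pos _).ne'
  constructor
  · rintro ⟨_, ⟨m, n, c₁, c₂, rfl⟩, h⟩
    obtain ⟨h1, h2⟩ := mem_calTs_iff.1 h
    exact ⟨⟨m, n⟩, ⟨_, h1⟩, ⟨_, h2⟩⟩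
  · rintro ⟨⟨m, n⟩, ⟨v, h1⟩, ⟨w, h2⟩⟩
    refine ⟨_, ⟨m, n, v / lam ^ (2 * rr s), w * lam ^ (2 * rr s), rfl⟩, mem_calTs_iff.2 ⟨?_, ?_⟩⟩
    · rwa [mul_div_cancel₀ _ hμ]
    · rwa [mul_div_cancel_right₀ _ hμ]

lemma abs_cos_add_sin_ge {θ : ℝ} (h : 0 ≤ Real.sin θ) : 1 ≤ triSupp θ := by
  have := Real.sin_sq_add_cos_sq θ
  rw [← sq_abs (Real.cos θ)] at this
  unfold triSupp
  nlinarith [abs_nonneg (Real.cos θ)]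

lemma triSupp_le {θ : ℝ} : triSupp θ ≤ 2 := by
  unfold triSupp; linarith [Real.abs_cos_le_one θ, Real.sin_le_one θ]

lemma one_lt_octSupp (θ : ℝ) : 1 < octSupp θ := by
  have h2 := sqrt_two_bounds
  have hl := lam_bounds
  have h1 : 1 ≤ |Real.cos θ| + |Real.sin θ| := by
    have := Real.sin_sq_add_cos_sq θ
    rw [← sq_abs (Real.cos θ), ← sq_abs (Real.sin θ)] at this
    nlinarith [abs_nonneg (Real.cos θ), abs_nonneg (Real.sin θ)]
  by_contra! h
  obtain ⟨ha, hb⟩ := max_le_iff.1 h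
  rw [div_le_one (by linarith)] at ha hb
  nlinarith

lemma octSupp_le (θ : ℝ) : octSupp θ ≤ 4 := by
  have h2 := sqrt_two_bounds
  have hl := lam_bounds
  have hc := Real.abs_cos_le_one θ
  have hs := Real.abs_sin_le_one θ
  apply max_le <;> rw [div_le_iff₀ (by linarith)] <;> nlinarith

lemma InTri.zero_of_lt {R θ w : ℝ} (h : |Real.cos θ| < Real.sin θ) (h0 : 0 < w) (hw : w < R) :
    InTri R θ 0 w := by
  have := Real.sin_le_one θ
  have hs := (abs_nonneg _).trans_lt h
  refine ⟨by nlinarith, ?_⟩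
  simp only [zero_mul, sub_zero, zero_add, abs_mul, abs_of_pos h0]
  nlinarith

lemma InTri.abs_lt {R θ u v : ℝ} (hs : 0 ≤ Real.sin θ) (h : Real.sin θ ≤ |Real.cos θ|)
    (hv : InTri R θ u v) : u ≠ 0 ∧ |u| < R * triSupp θ := by
  obtain ⟨h1, h2⟩ := hv
  have hsc := Real.sin_sq_add_cos_sq θ
  set p := u * Real.cos θ + v * Real.sin θ with hp
  set q := v * Real.cos θ - u * Real.sin θ with hq
  have hu : u = p * Real.cos θ - q * Real.sin θ := by
    rw [hp, hq]; linear_combination (-u) * hsc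
  have hp0 : 0 < p := (abs_nonneg _).trans_lt h2
  have hC : 0 < |Real.cos θ| := by
    rw [← sq_abs (Real.cos θ)] at hsc
    nlinarith [abs_nonneg (Real.cos θ)]
  have e1 : |p * Real.cos θ| = p * |Real.cos θ| := by rw [abs_mul, abs_of_pos hp0]
  have e2 : |q * Real.sin θ| = |q| * Real.sin θ := by rw [abs_mul, abs_of_nonneg hs]
  constructor
  · intro h0
    have : p * Real.cos θ = q * Real.sin θ := by linarith
    rw [this, e2] at e1
    nlinarith [abs_nonneg q]
  · have := abs_sub (p * Real.cos θ) (q * Real.sin θ)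
    rw [← hu, e1, e2] at this
    unfold triSupp
    nlinarith [abs_nonneg q]

lemma InTri.of_slice {R θ τ e w : ℝ} (hs : 0 ≤ Real.sin θ) (h : Real.sin θ ≤ |Real.cos θ|)
    (he : e * e = 1) (hc : Real.cos θ = e * |Real.cos θ|)
    (hw : 0 < w) (hw1 : w < R * τ) (hw2 : w < R * (1 - τ)) :
    InTri R θ (e * (τ * (R * triSupp θ))) (τ * R * (Real.sin θ - |Real.cos θ|) + w) := by
  have hsc := Real.sin_sq_add_cos_sq θ
  rw [← sq_abs (Real.cos θ)] at hsc
  have hs1 := Real.sin_le_one θ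
  have hC1 := Real.abs_cos_le_one θ
  have hC : 0 < |Real.cos θ| := by nlinarith [abs_nonneg (Real.cos θ)]
  unfold InTri triSupp
  rw [hc, abs_mul, abs_abs]
  set C := |Real.cos θ|
  set S := Real.sin θ
  have hea : |e| = 1 := by
    have : |e| * |e| = 1 := by rw [← abs_mul, he, abs_one]
    nlinarith [abs_nonneg e]
  rw [hea, one_mul]
  have e1 : e * (τ * (R * (C + S))) * (e * C) + (τ * R * (S - C) + w) * S = τ * R + w * S := by
    linear_combination (τ * R * (C + S) * C) * he + τ * R * hsc
  have e2 : (τ * R * (S - C) + w) * (e * C) - e * (τ * (R * (C + S))) * S =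
      e * (w * C - τ * R) := by
    linear_combination (-e * τ * R) * hsc
  rw [e1, e2, abs_mul, hea, one_mul]
  refine ⟨by nlinarith, _root_.abs_lt.2 ⟨by nlinarith, ?_⟩⟩
  have : w * C ≤ w := by nlinarith
  have : 0 ≤ w * S := by positivity
  nlinarith

lemma InOct.abs_lt {θ u v : ℝ} (hv : InOct θ u v) : |u| < octSupp θ := by
  have h2 := sqrt_two_bounds
  obtain ⟨h1, h3, h4⟩ := hv
  have hsc := Real.sin_sq_add_cos_sq θ
  simp only at h1 h3 h4
  set p := u * Real.cos θ + v * Real.sin θ with hp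
  set q := v * Real.cos θ - u * Real.sin θ with hq
  have hu : u = p * Real.cos θ - q * Real.sin θ := by
    rw [hp, hq]; linear_combination (-u) * hsc
  have := abs_sub (p * Real.cos θ) (q * Real.sin θ)
  rw [← hu, abs_mul, abs_mul] at this
  rw [← sq_abs (Real.cos θ), ← sq_abs (Real.sin θ)] at hsc
  rw [lt_div_iff₀ (by linarith)] at h1 h3
  have hlam : lam = 1 + Real.sqrt 2 := rfl
  have hp0 := abs_nonneg p
  have hq0 := abs_nonneg q
  have hC := abs_nonneg (Real.cos θ)
  have hS := abs_nonneg (Real.sin θ)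
  unfold octSupp
  set C := |Real.cos θ|
  set S := |Real.sin θ|
  rcases le_total S C with h | h
  · apply lt_max_of_lt_left
    rw [lt_div_iff₀ (by linarith)]
    have hCp : 0 < C := by nlinarith
    have : |u| * Real.sqrt 2 ≤ (|p| * C + |q| * S) * Real.sqrt 2 := by nlinarith
    have : (|p| * C + |q| * S) * Real.sqrt 2 =
      (|p| + |q|) * (S * Real.sqrt 2) + (|p| * Real.sqrt 2) * (C - S) := by ring
    have h5 : (|p| + |q|) * (S * Real.sqrt 2) ≤ lam * (S * Real.sqrt 2) := by
      apply mul_le_mul_of_nonneg_right h4.le; positivity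
    have h6 : (|p| * Real.sqrt 2) * (C - S) ≤ lam * (C - S) :=
      mul_le_mul_of_nonneg_right h1.le (by linarith)
    have h7 : lam * (S * Real.sqrt 2) = lam * S + S := by
      rw [hlam]; linear_combination S * sqrt_two_sq
    rcases h.lt_or_eq with h' | h'
    · have : (|p| * Real.sqrt 2) * (C - S) < lam * (C - S) :=
        mul_lt_mul_of_pos_right h1 (by linarith)
      linarith
    · have : (|p| + |q|) * (S * Real.sqrt 2) < lam * (S * Real.sqrt 2) := by
        apply mul_lt_mul_of_pos_right h4
        rw [h']; apply mul_pos hCp; linarith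
      linarith
  · apply lt_max_of_lt_right
    rw [lt_div_iff₀ (by linarith)]
    have hSp : 0 < S := by nlinarith
    have : |u| * Real.sqrt 2 ≤ (|p| * C + |q| * S) * Real.sqrt 2 := by nlinarith
    have : (|p| * C + |q| * S) * Real.sqrt 2 =
      (|p| + |q|) * (C * Real.sqrt 2) + (|q| * Real.sqrt 2) * (S - C) := by ring
    have h5 : (|p| + |q|) * (C * Real.sqrt 2) ≤ lam * (C * Real.sqrt 2) := by
      apply mul_le_mul_of_nonneg_right h4.le; positivity
    have h6 : (|q| * Real.sqrt 2) * (S - C) ≤ lam * (S - C) :=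
      mul_le_mul_of_nonneg_right h3.le (by linarith)
    have h7 : lam * (C * Real.sqrt 2) = lam * C + C := by
      rw [hlam]; linear_combination C * sqrt_two_sq
    rcases h.lt_or_eq with h' | h'
    · have : (|q| * Real.sqrt 2) * (S - C) < lam * (S - C) :=
        mul_lt_mul_of_pos_right h3 (by linarith)
      linarith
    · have : (|p| + |q|) * (C * Real.sqrt 2) < lam * (C * Real.sqrt 2) := by
        apply mul_lt_mul_of_pos_right h4
        rw [h']; apply mul_pos hSp; linarith
      linarith

/-- A point of the closed octagon where the support function is attained. -/
lemma exists_octSupp_eq (θ : ℝ) : ∃ p q : ℝ, |p| * Real.sqrt 2 ≤ lam ∧ |q| * Real.sqrt 2 ≤ lam ∧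
    |p| + |q| ≤ lam ∧ p * Real.cos θ - q * Real.sin θ = octSupp θ := by
  have h2 := sqrt_two_bounds
  have hl := lam_bounds
  have h2p : 0 < Real.sqrt 2 := by linarith
  have hlam : lam = 1 + Real.sqrt 2 := rfl
  have hsum : lam / Real.sqrt 2 + 1 / Real.sqrt 2 = lam := by
    rw [hlam]; field_simp; linarith [sqrt_two_sq]
  have sgn : ∀ x : ℝ, ∃ e : ℝ, |e| = 1 ∧ e * x = |x| := by
    intro x
    rcases le_total 0 x with h | h
    · exact ⟨1, by simp, by rw [abs_of_nonneg h, one_mul]⟩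
    · exact ⟨-1, by simp, by rw [abs_of_nonpos h]; ring⟩
  obtain ⟨e, he, hec⟩ := sgn (Real.cos θ)
  obtain ⟨f, hf, hfs⟩ := sgn (Real.sin θ)
  have a1 : |lam / Real.sqrt 2| = lam / Real.sqrt 2 := abs_of_pos (div_pos lam_pos h2p)
  have a2 : |1 / Real.sqrt 2| = 1 / Real.sqrt 2 := abs_of_pos (by positivity)
  have b1 : lam / Real.sqrt 2 * Real.sqrt 2 ≤ lam := (div_mul_cancel₀ _ h2p.ne').le
  have b2 : 1 / Real.sqrt 2 * Real.sqrt 2 ≤ lam := by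
    rw [div_mul_cancel₀ _ h2p.ne']; linarith
  rcases max_choice ((lam * |Real.cos θ| + |Real.sin θ|) / Real.sqrt 2)
    ((|Real.cos θ| + lam * |Real.sin θ|) / Real.sqrt 2) with h | h
  · refine ⟨lam / Real.sqrt 2 * e, -(1 / Real.sqrt 2 * f), ?_, ?_, ?_, ?_⟩
    · rw [abs_mul, he, a1, mul_one]; exact b1
    · rw [abs_neg, abs_mul, hf, a2, mul_one]; exact b2
    · rw [abs_neg, abs_mul, abs_mul, hf, a2, he, a1, mul_one, mul_one]; exact hsum.le
    · rw [octSupp, h, ← hec, ← hfs]; ring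
  · refine ⟨1 / Real.sqrt 2 * e, -(lam / Real.sqrt 2 * f), ?_, ?_, ?_, ?_⟩
    · rw [abs_mul, he, a2, mul_one]; exact b2
    · rw [abs_neg, abs_mul, hf, a1, mul_one]; exact b1
    · rw [abs_neg, abs_mul, abs_mul, hf, a1, he, a2, mul_one, mul_one]; linarith
    · rw [octSupp, h, ← hec, ← hfs]; ring

lemma InOct.of_slice (θ : ℝ) {ε τ : ℝ} (hε : |ε| = 1) (hτ0 : 0 ≤ τ) (hτ : τ < 1) :
    ∃ v, ∀ w, |w - v| < 1 - τ → InOct θ (ε * (τ * octSupp θ)) w := by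
  obtain ⟨p, q, hp, hq, hpq, hb⟩ := exists_octSupp_eq θ
  have h2 := sqrt_two_bounds
  have hl := lam_bounds
  have hsc := Real.sin_sq_add_cos_sq θ
  refine ⟨ε * τ * (p * Real.sin θ + q * Real.cos θ), fun w hw => ?_⟩
  rw [← hb]
  set z := w - ε * τ * (p * Real.sin θ + q * Real.cos θ) with hz
  have e1 : ε * (τ * (p * Real.cos θ - q * Real.sin θ)) * Real.cos θ + w * Real.sin θ =
      ε * τ * p + z * Real.sin θ := by
    rw [hz]; linear_combination (ε * τ * p) * hsc
  have e2 : w * Real.cos θ - ε * (τ * (p * Real.cos θ - q * Real.sin θ)) * Real.sin θ =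
      ε * τ * q + z * Real.cos θ := by
    rw [hz]; linear_combination (ε * τ * q) * hsc
  have f1 : |ε * τ * p + z * Real.sin θ| ≤ τ * |p| + |z| * |Real.sin θ| := by
    refine (abs_add_le _ _).trans_eq ?_
    rw [abs_mul, abs_mul, abs_mul, hε, abs_of_nonneg hτ0, one_mul]
  have f2 : |ε * τ * q + z * Real.cos θ| ≤ τ * |q| + |z| * |Real.cos θ| := by
    refine (abs_add_le _ _).trans_eq ?_
    rw [abs_mul, abs_mul, abs_mul, hε, abs_of_nonneg hτ0, one_mul]
  have hs1 := Real.abs_sin_le_one θ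
  have hc1 := Real.abs_cos_le_one θ
  have hz0 := abs_nonneg z
  have g1 : |z| * |Real.sin θ| ≤ |z| := mul_le_of_le_one_right hz0 hs1
  have g2 : |z| * |Real.cos θ| ≤ |z| := mul_le_of_le_one_right hz0 hc1
  refine ⟨?_, ?_, ?_⟩ <;> simp only [e1, e2]
  · rw [lt_div_iff₀ (by linarith)]
    nlinarith
  · rw [lt_div_iff₀ (by linarith)]
    nlinarith
  · nlinarith

lemma Ltilde_inter_nonempty_of_abs_cos_lt {s y₁ y₂ θ₁ θ₂ : ℝ}
    (hR : 0 < Real.sqrt (s / thetaHat)) (h : |Real.cos θ₁| < Real.sin θ₁) :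
    (Ltilde y₁ y₂ θ₁ θ₂ ∩ calTs s).Nonempty := by
  rw [Ltilde_inter_nonempty_iff]
  obtain ⟨v, hv⟩ := InOct.of_slice θ₂ (ε := 1) (τ := 0) (by simp) le_rfl one_pos
  refine ⟨0, ⟨Real.sqrt (s / thetaHat) / 2, ?_⟩, ⟨v, ?_⟩⟩
  · rw [emb_zero, zero_mul, mul_zero]
    exact InTri.zero_of_lt h (by positivity) (by linarith)
  · have := hv v (by simp)
    rw [embc_zero, zero_mul, zero_div]
    simpa using this

lemma exists_sign (x : ℝ) : ∃ e : ℝ, (e = 1 ∨ e = -1) ∧ x = e * |x| := by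
  rcases le_total 0 x with h | h
  · exact ⟨1, by simp, by rw [abs_of_nonneg h, one_mul]⟩
  · exact ⟨-1, by simp, by rw [abs_of_nonpos h]; ring⟩

/-- Signed version of `exists_unit`. -/
lemma exists_signed_unit {e : ℝ} (he : e = 1 ∨ e = -1) (k : ℤ) : ∃ (u : Zsqrtd 2) (ε : ℝ),
    |ε| = 1 ∧ emb u = e * lam ^ k ∧ embc u = ε * lam ^ (-k) := by
  obtain ⟨u, ε, hε, hu, hu'⟩ := exists_unit k
  have hεa : |ε| = 1 := by rcases hε with rfl | rfl <;> norm_num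
  rcases he with rfl | rfl
  · exact ⟨u, ε, hεa, by rw [hu, one_mul], hu'⟩
  · exact ⟨-u, -ε, by rwa [abs_neg], by rw [emb_neg, hu]; ring, by rw [embc_neg, hu']; ring⟩

lemma Ltilde_inter_nonempty_iff_unit {s y₁ y₂ θ₁ θ₂ : ℝ} (hy₁ : 0 < y₁) (hy₂ : 0 < y₂)
    (hR : 0 < Real.sqrt (s / thetaHat)) (hs : 0 ≤ Real.sin θ₁)
    (h : Real.sin θ₁ ≤ |Real.cos θ₁|) :
    (Ltilde y₁ y₂ θ₁ θ₂ ∩ calTs s).Nonempty ↔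
      ∃ k : ℤ, lam ^ k * y₁ < Real.sqrt (s / thetaHat) * triSupp θ₁ / lam ^ (2 * rr s) ∧
        lam ^ (-k) * y₂ < octSupp θ₂ * lam ^ (2 * rr s) := by
  have hμ : 0 < lam ^ (2 * rr s) := zpow_pos lam_pos _
  rw [Ltilde_inter_nonempty_iff]
  set μ := lam ^ (2 * rr s)
  set R := Real.sqrt (s / thetaHat)
  have hc : 0 < R * triSupp θ₁ := mul_pos hR (one_pos.trans_le (abs_cos_add_sin_ge hs))
  have hb : 0 < octSupp θ₂ := one_pos.trans (one_lt_octSupp θ₂)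
  constructor
  · rintro ⟨α, ⟨v, hv⟩, ⟨w, hw⟩⟩
    obtain ⟨h0, h1⟩ := hv.abs_lt hs h
    have h2 := hw.abs_lt
    have h0' : emb α ≠ 0 := by rintro h'; simp [h'] at h0
    rw [abs_mul, abs_mul, abs_of_pos hμ, abs_of_pos hy₁] at h1
    rw [abs_div, abs_mul, abs_of_pos hμ, abs_of_pos hy₂, div_lt_iff₀ hμ] at h2
    obtain ⟨k, hk, hk'⟩ := exists_unit_of_exists (α := α) (A := R * triSupp θ₁ / μ / y₁)
      (B := octSupp θ₂ * μ / y₂) h0'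
      (by rw [lt_div_iff₀ hy₁, lt_div_iff₀ hμ]; linarith) (by rwa [lt_div_iff₀ hy₂])
    exact ⟨k, by rwa [← lt_div_iff₀ hy₁], by rwa [← lt_div_iff₀ hy₂]⟩
  · rintro ⟨k, hk, hk'⟩
    obtain ⟨e, he, hec⟩ := exists_sign (Real.cos θ₁)
    obtain ⟨u, ε, hε, hu, hu'⟩ := exists_signed_unit he k
    have hee : e * e = 1 := by rcases he with rfl | rfl <;> norm_num
    have hkp : 0 < lam ^ k := zpow_pos lam_pos k
    have hkp' : 0 < lam ^ (-k) := zpow_pos lam_pos _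
    rw [lt_div_iff₀ hμ] at hk
    set τ₁ := lam ^ k * y₁ * μ / (R * triSupp θ₁) with hτ₁
    set τ₂ := lam ^ (-k) * y₂ / (octSupp θ₂ * μ) with hτ₂
    have h1 : τ₁ < 1 := by rwa [div_lt_one hc]
    have h1' : 0 < τ₁ := by positivity
    have h2 : τ₂ < 1 := by rwa [div_lt_one (by positivity)]
    obtain ⟨v, hv⟩ := InOct.of_slice θ₂ hε (by positivity : 0 ≤ τ₂) h2
    have hm : 0 < min (R * τ₁) (R * (1 - τ₁)) :=
      lt_min (by positivity) (mul_pos hR (by linarith))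
    refine ⟨u, ⟨τ₁ * R * (Real.sin θ₁ - |Real.cos θ₁|) + min (R * τ₁) (R * (1 - τ₁)) / 2,
      ?_⟩, ⟨v, ?_⟩⟩
    · have e1 : μ * (emb u * y₁) = e * (τ₁ * (R * triSupp θ₁)) := by
        rw [hu, hτ₁, div_mul_cancel₀ _ hc.ne']; ring
      rw [e1]
      apply InTri.of_slice hs h hee hec (by positivity)
      · linarith [min_le_left (R * τ₁) (R * (1 - τ₁))]
      · linarith [min_le_right (R * τ₁) (R * (1 - τ₁))]
    · have e2 : embc u * y₂ / μ = ε * (τ₂ * octSupp θ₂) := by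
        rw [hu', hτ₂]; field_simp
      rw [e2]
      apply hv
      simp [h2]

/-- If the lattice misses the target, then every slice through a unit has small area. -/
lemma slice_area_lt {s x₁ x₂ y₁ y₂ θ₁ θ₂ : ℝ} (hy₁ : 0 < y₁) (hy₂ : 0 < y₂)
    (hR : 0 < Real.sqrt (s / thetaHat)) (hs : 0 ≤ Real.sin θ₁)
    (h : Real.sin θ₁ ≤ |Real.cos θ₁|)
    (hempty : latimage (hmat x₁ x₂ y₁ y₂ θ₁ θ₂) ∩ calTs s = ∅) {k : ℤ} {τ₁ τ₂ : ℝ}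
    (hτ₁ : lam ^ k * y₁ = τ₁ * (Real.sqrt (s / thetaHat) * triSupp θ₁ / lam ^ (2 * rr s)))
    (hτ₂ : lam ^ (-k) * y₂ = τ₂ * (octSupp θ₂ * lam ^ (2 * rr s)))
    (h1 : τ₁ < 1) (h2 : τ₂ < 1) :
    Real.sqrt (s / thetaHat) * (y₁ * y₂) * (min τ₁ (1 - τ₁) * (1 - τ₂)) < 18 := by
  have hμ : 0 < lam ^ (2 * rr s) := zpow_pos lam_pos _
  rw [latimage_inter_eq_empty_iff] at hempty
  set μ := lam ^ (2 * rr s)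
  set R := Real.sqrt (s / thetaHat)
  have hc : 0 < R * triSupp θ₁ := mul_pos hR (one_pos.trans_le (abs_cos_add_sin_ge hs))
  have hb : 0 < octSupp θ₂ := one_pos.trans (one_lt_octSupp θ₂)
  obtain ⟨e, he, hec⟩ := exists_sign (Real.cos θ₁)
  obtain ⟨u, ε, hε, hu, hu'⟩ := exists_signed_unit he k
  have hee : e * e = 1 := by rcases he with rfl | rfl <;> norm_num
  have hkp : 0 < lam ^ k := zpow_pos lam_pos k
  have hkp' : 0 < lam ^ (-k) := zpow_pos lam_pos _
  have h1' : 0 < τ₁ := by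
    have : 0 < τ₁ * (R * triSupp θ₁ / μ) := by rw [← hτ₁]; positivity
    exact pos_of_mul_pos_left this (by positivity)
  have h2' : 0 < τ₂ := by
    have : 0 < τ₂ * (octSupp θ₂ * μ) := by rw [← hτ₂]; positivity
    exact pos_of_mul_pos_left this (by positivity)
  by_contra! hbig
  obtain ⟨v, hv⟩ := InOct.of_slice θ₂ hε h2'.le h2
  set m := min τ₁ (1 - τ₁)
  have hm : 0 < m := lt_min h1' (by linarith)
  have hm1 : m ≤ τ₁ := min_le_left _ _
  have hm2 : m ≤ 1 - τ₁ := min_le_right _ _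
  set v₀ := τ₁ * R * (Real.sin θ₁ - |Real.cos θ₁|)
  obtain ⟨β, hβ, hβ'⟩ := exists_lattice_point (ρ₁ := y₁ * R * m / (2 * μ))
    (ρ₂ := y₂ * μ * (1 - τ₂)) ((v₀ + R * m / 2) * y₁ / μ - emb u * x₁)
    (v * y₂ * μ - embc u * x₂) (by positivity) (by
      have : y₁ * R * m / (2 * μ) * (y₂ * μ * (1 - τ₂)) =
        R * (y₁ * y₂) * (m * (1 - τ₂)) / 2 := by field_simp
      rw [this]; linarith)
  refine hempty u β ⟨?_, ?_⟩
  · have e1 : μ * (emb u * y₁) = e * (τ₁ * (R * triSupp θ₁)) := by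
      rw [hu, mul_assoc, hτ₁]; field_simp
    rw [e1]
    set w := μ * ((emb u * x₁ + emb β) / y₁) - v₀ with hw
    have e2 : μ * ((emb u * x₁ + emb β) / y₁) = v₀ + w := by rw [hw]; ring
    have e3 : emb β - ((v₀ + R * m / 2) * y₁ / μ - emb u * x₁) =
        (w - R * m / 2) * (y₁ / μ) := by
      rw [hw]; field_simp; ring
    have e4 : |w - R * m / 2| < R * m / 2 := by
      rw [e3, abs_mul, abs_of_pos (by positivity : 0 < y₁ / μ)] at hβ
      refine lt_of_mul_lt_mul_right (hβ.trans_eq ?_) (by positivity : 0 ≤ y₁ / μ)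
      field_simp
    rw [abs_lt] at e4
    have : R * m ≤ R * τ₁ := by gcongr
    have : R * m ≤ R * (1 - τ₁) := by gcongr
    rw [e2]
    exact InTri.of_slice hs h hee hec (by linarith) (by linarith) (by linarith)
  · have e1 : embc u * y₂ / μ = ε * (τ₂ * octSupp θ₂) := by
      rw [hu', mul_assoc, hτ₂]; field_simp
    rw [e1]
    apply hv
    have e3 : embc β - (v * y₂ * μ - embc u * x₂) =
        ((embc u * x₂ + embc β) / y₂ / μ - v) * (y₂ * μ) := by
      field_simp; ring
    rw [e3, abs_mul, abs_of_pos (by positivity : 0 < y₂ * μ), mul_comm (y₂ * μ)] at hβ'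
    exact lt_of_mul_lt_mul_right hβ' (by positivity)

lemma latimage_inter_ne_empty_of_abs_cos_lt {s x₁ x₂ y₁ y₂ θ₁ θ₂ : ℝ} (hy₁ : 0 < y₁)
    (hy₂ : 0 < y₂) (hR : 0 < Real.sqrt (s / thetaHat)) (h : |Real.cos θ₁| < Real.sin θ₁)
    (hbig : 18 ≤ Real.sqrt (s / thetaHat) * (y₁ * y₂)) :
    latimage (hmat x₁ x₂ y₁ y₂ θ₁ θ₂) ∩ calTs s ≠ ∅ := by
  have hμ : 0 < lam ^ (2 * rr s) := zpow_pos lam_pos _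
  rw [Ne, latimage_inter_eq_empty_iff]
  push Not
  set μ := lam ^ (2 * rr s)
  set R := Real.sqrt (s / thetaHat)
  obtain ⟨v, hv⟩ := InOct.of_slice θ₂ (ε := 1) (τ := 0) (by simp) le_rfl one_pos
  obtain ⟨β, hβ, hβ'⟩ := exists_lattice_point (ρ₁ := R * y₁ / (2 * μ))
    (ρ₂ := y₂ * μ) (R * y₁ / (2 * μ)) (v * (y₂ * μ)) (by positivity) (by
      have : R * y₁ / (2 * μ) * (y₂ * μ) = R * (y₁ * y₂) / 2 := by field_simp
      rw [this]; linarith)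
  refine ⟨0, β, ?_, ?_⟩
  · rw [emb_zero]
    simp only [zero_mul, mul_zero, zero_add]
    rw [abs_lt] at hβ
    have e : R * y₁ / (2 * μ) = R / 2 * (y₁ / μ) := by field_simp
    have e' : emb β = μ * (emb β / y₁) * (y₁ / μ) := by field_simp
    have hp : 0 < y₁ / μ := by positivity
    rw [e, e'] at hβ
    apply InTri.zero_of_lt h
    · apply pos_of_mul_pos_left (b := y₁ / μ) _ hp.le
      linarith
    · refine lt_of_mul_lt_mul_right (a := y₁ / μ) ?_ hp.le
      linarith
  · have h0 := hv (embc β / y₂ / μ) (by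
      rw [sub_zero]
      have e : embc β - v * (y₂ * μ) = (embc β / y₂ / μ - v) * (y₂ * μ) := by field_simp
      have hp : 0 < y₂ * μ := by positivity
      rw [e, abs_mul, abs_of_pos hp] at hβ'
      refine lt_of_mul_lt_mul_right (a := y₂ * μ) ?_ hp.le
      linarith)
    rw [embc_zero]
    simpa using h0

lemma thetaHat_bounds : 1/4 ≤ thetaHat ∧ thetaHat ≤ 1 := by
  have h2 := sqrt_two_bounds
  have h1 : (3.14:ℝ) ^ 4 < Real.pi ^ 4 := by gcongr; exact Real.pi_gt_d2
  have h3 : Real.pi ^ 4 < (3.15:ℝ) ^ 4 := by gcongr; exact Real.pi_lt_d2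
  unfold thetaHat
  constructor
  · rw [le_div_iff₀ (by positivity)]
    norm_num at h3 ⊢; linarith
  · rw [div_le_one (by positivity)]
    norm_num at h1 ⊢; linarith

lemma sqrt_le_sqrt_div_thetaHat {s : ℝ} (hs : 0 < s) :
    Real.sqrt s ≤ Real.sqrt (s / thetaHat) ∧ Real.sqrt (s / thetaHat) ≤ 2 * Real.sqrt s := by
  obtain ⟨h1, h2⟩ := thetaHat_bounds
  have h0 : 0 < thetaHat := by linarith
  constructor
  · exact Real.sqrt_le_sqrt (by rw [le_div_iff₀ h0]; nlinarith)
  · rw [Real.sqrt_le_left (by positivity), mul_pow, Real.sq_sqrt hs.le, div_le_iff₀ h0]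
    nlinarith

lemma lam_zpow_rr_bounds {s : ℝ} (hs : 0 < s) :
    (lam ^ (2 * rr s)) ^ 2 ≤ Real.sqrt (s / thetaHat) ∧
      Real.sqrt (s / thetaHat) ≤ 72 * (lam ^ (2 * rr s)) ^ 2 := by
  have hx : 0 < s ^ ((1:ℝ)/4) := Real.rpow_pos_of_pos hs _
  have hl := lam_bounds
  have hl2 : 1 < lam ^ 2 := by nlinarith
  have hx2 : (s ^ ((1:ℝ)/4)) ^ 2 = Real.sqrt s := by
    rw [← Real.rpow_natCast, ← Real.rpow_mul hs.le, Real.sqrt_eq_rpow]; norm_num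
  have e : lam ^ (2 * rr s) = (lam ^ 2) ^ ((rr s : ℤ) : ℝ) := by
    rw [Real.rpow_intCast, _root_.zpow_mul]; norm_cast
  have h1 : lam ^ (2 * rr s) ≤ s ^ ((1:ℝ)/4) := by
    rw [e, ← Real.le_logb_iff_rpow_le hl2 hx]
    exact Int.floor_le _
  have h2 : s ^ ((1:ℝ)/4) < lam ^ 2 * lam ^ (2 * rr s) := by
    have : s ^ ((1:ℝ)/4) < (lam ^ 2) ^ (((rr s : ℤ) : ℝ) + 1) := by
      rw [← Real.logb_lt_iff_lt_rpow hl2 hx]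
      exact Int.lt_floor_add_one _
    rw [Real.rpow_add (by linarith), Real.rpow_one, ← e] at this
    linarith
  have hμ : 0 < lam ^ (2 * rr s) := zpow_pos lam_pos _
  obtain ⟨h3, h4⟩ := sqrt_le_sqrt_div_thetaHat hs
  constructor
  · refine le_trans ?_ h3
    rw [← hx2]; gcongr
  · have h5 : s ^ ((1:ℝ)/4) ≤ 6 * lam ^ (2 * rr s) := by
      have : lam ^ 2 ≤ 6 := by nlinarith
      nlinarith
    have : Real.sqrt s ≤ (6 * lam ^ (2 * rr s)) ^ 2 := by rw [← hx2]; gcongr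
    nlinarith

/-- The scale `R = (s/θ̂)^{1/2}` of the triangle. -/
def triScale (s : ℝ) : ℝ := Real.sqrt (s / thetaHat)

/-- The width of the rescaled triangle. -/
def triWidth (s θ : ℝ) : ℝ := triScale s * triSupp θ / lam ^ (2 * rr s)

/-- The half-width of the rescaled octagon. -/
def octWidth (s θ : ℝ) : ℝ := octSupp θ * lam ^ (2 * rr s)

lemma triScale_pos {s : ℝ} (hs : 0 < s) : 0 < triScale s :=
  (Real.sqrt_pos.2 hs).trans_le (sqrt_le_sqrt_div_thetaHat hs).1

lemma triWidth_bounds {s θ : ℝ} (hs : 0 < s) (h : 0 ≤ Real.sin θ) :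
    0 < triWidth s θ ∧ triWidth s θ ≤ 17 * Real.sqrt (triScale s) := by
  have hμ : 0 < lam ^ (2 * rr s) := zpow_pos lam_pos _
  have hR := triScale_pos hs
  have h1 := abs_cos_add_sin_ge h
  have h2 := triSupp_le (θ := θ)
  refine ⟨div_pos (mul_pos hR (by linarith)) hμ, ?_⟩
  unfold triWidth
  rw [div_le_iff₀ hμ]
  obtain ⟨-, h4⟩ := lam_zpow_rr_bounds hs
  change triScale s ≤ _ at h4
  have hr := Real.mul_self_sqrt hR.le
  set r := Real.sqrt (triScale s)
  have hr0 : 0 < r := Real.sqrt_pos.2 hR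
  have : 2 * r ≤ 17 * lam ^ (2 * rr s) := by
    apply le_of_sq_le_sq _ (by positivity)
    nlinarith
  calc triScale s * triSupp θ ≤ triScale s * 2 := by gcongr
    _ = r * (2 * r) := by rw [← hr]; ring
    _ ≤ r * (17 * lam ^ (2 * rr s)) := by gcongr
    _ = _ := by ring

lemma octWidth_bounds {s θ : ℝ} (hs : 0 < s) :
    0 < octWidth s θ ∧ octWidth s θ ≤ 4 * Real.sqrt (triScale s) := by
  have hμ : 0 < lam ^ (2 * rr s) := zpow_pos lam_pos _
  have h1 := one_lt_octSupp θ
  refine ⟨mul_pos (by linarith) hμ, ?_⟩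
  unfold octWidth
  have h3 : lam ^ (2 * rr s) ≤ Real.sqrt (triScale s) :=
    Real.le_sqrt_of_sq_le (lam_zpow_rr_bounds hs).1
  exact mul_le_mul (octSupp_le θ) h3 hμ.le (by norm_num)

lemma triWidth_mul_octWidth {s θ₁ θ₂ : ℝ} :
    triWidth s θ₁ * octWidth s θ₂ = triScale s * (triSupp θ₁ * octSupp θ₂) := by
  have hμ : 0 < lam ^ (2 * rr s) := zpow_pos lam_pos _
  unfold triWidth octWidth
  field_simp

lemma le_triWidth_mul_octWidth {s θ₁ θ₂ : ℝ} (hs : 0 < s) (h : 0 ≤ Real.sin θ₁) :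
    triScale s ≤ triWidth s θ₁ * octWidth s θ₂ ∧
      triWidth s θ₁ * octWidth s θ₂ ≤ 8 * triScale s := by
  have hR := triScale_pos hs
  have h1 := abs_cos_add_sin_ge h
  have h2 := triSupp_le (θ := θ₁)
  have h3 := (one_lt_octSupp θ₂).le
  have h4 := octSupp_le θ₂
  rw [triWidth_mul_octWidth]
  have h5 : 1 ≤ triSupp θ₁ * octSupp θ₂ := by nlinarith
  have h6 : triSupp θ₁ * octSupp θ₂ ≤ 8 := by nlinarith
  constructor <;> nlinarith

/-- The exceptional set of `(y₁, y₂)`, where some slice through a unit is short. -/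
def thinSet (R c b : ℝ) : Set (ℝ × ℝ) :=
  ⋃ k ∈ Finset.Icc (-7 : ℤ) 7,
    (Icc ((1 - 50 / R) * (c * lam ^ (-k))) (c * lam ^ (-k)) ×ˢ Icc 0 (7 * Real.sqrt R)) ∪
    (Icc 0 (7 * Real.sqrt R) ×ˢ Icc ((1 - 50 / R) * (b * lam ^ k)) (b * lam ^ k))

lemma measurableSet_thinSet (R c b : ℝ) : MeasurableSet (thinSet R c b) :=
  Finset.measurableSet_biUnion _ fun _ _ =>
    (measurableSet_Icc.prod measurableSet_Icc).union (measurableSet_Icc.prod measurableSet_Icc)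

lemma lam_zpow_le {k : ℤ} (hk : k ≤ 7) : lam ^ k ≤ 3 ^ 7 := by
  calc lam ^ k ≤ lam ^ (7:ℤ) := zpow_le_zpow_right₀ one_lt_lam.le hk
    _ = lam ^ 7 := by norm_cast
    _ ≤ 3 ^ 7 := by
      have := lam_bounds
      gcongr
      · exact lam_pos.le
      · linarith

lemma volume_thinSet_le {R c b : ℝ} (hR : 0 < R) (hc : 0 < c) (hb : 0 < b)
    (hc' : c ≤ 17 * Real.sqrt R) (hb' : b ≤ 4 * Real.sqrt R) :
    volume (thinSet R c b) ≤ ENNReal.ofReal (15 * (350 * 21 * 3 ^ 7)) := by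
  have hr := Real.mul_self_sqrt hR.le
  have hr0 : 0 < Real.sqrt R := Real.sqrt_pos.2 hR
  have aux : ∀ x M q : ℝ, x ≤ M * Real.sqrt R → 0 < q → 0 < x → q ≤ 3 ^ 7 →
      (x * q - (1 - 50 / R) * (x * q)) * (7 * Real.sqrt R) ≤ 350 * M * 3 ^ 7 := by
    intro x M q hx hq hx0 hq'
    have e : (x * q - (1 - 50 / R) * (x * q)) * (7 * Real.sqrt R) =
        350 * (x * q) * Real.sqrt R / R := by field_simp; ring
    rw [e, div_le_iff₀ hR]
    calc 350 * (x * q) * Real.sqrt R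
        ≤ 350 * (M * Real.sqrt R * 3 ^ 7) * Real.sqrt R := by
          gcongr; exact (hx0.trans_le hx).le
      _ = 350 * M * 3 ^ 7 * (Real.sqrt R * Real.sqrt R) := by ring
      _ = _ := by rw [hr]
  have hp : ∀ k : ℤ, 0 < lam ^ k := fun k => zpow_pos lam_pos k
  calc volume (thinSet R c b) ≤ ∑ k ∈ Finset.Icc (-7 : ℤ) 7, volume
        ((Icc ((1 - 50 / R) * (c * lam ^ (-k))) (c * lam ^ (-k)) ×ˢ Icc 0 (7 * Real.sqrt R)) ∪
        (Icc 0 (7 * Real.sqrt R) ×ˢ Icc ((1 - 50 / R) * (b * lam ^ k)) (b * lam ^ k))) :=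
        measure_biUnion_finset_le _ _
    _ ≤ ∑ k ∈ Finset.Icc (-7 : ℤ) 7, ENNReal.ofReal (350 * 21 * 3 ^ 7) := by
        apply Finset.sum_le_sum
        intro k hk
        rw [Finset.mem_Icc] at hk
        refine (measure_union_le _ _).trans ?_
        rw [Measure.volume_eq_prod, Measure.prod_prod, Measure.prod_prod, Real.volume_Icc,
          Real.volume_Icc, Real.volume_Icc, sub_zero,
          ← ENNReal.ofReal_mul' (by positivity), ← ENNReal.ofReal_mul (by positivity)]
        have h1 := aux c 17 (lam ^ (-k)) hc' (hp _) hc (lam_zpow_le (by omega))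
        have h2 := aux b 4 (lam ^ k) hb' (hp _) hb (lam_zpow_le (by omega))
        rw [mul_comm (7 * Real.sqrt R)]
        refine (add_le_add (ENNReal.ofReal_le_ofReal h1) (ENNReal.ofReal_le_ofReal h2)).trans_eq ?_
        rw [← ENNReal.ofReal_add (by norm_num) (by norm_num)]
        norm_num
    _ = ENNReal.ofReal (15 * (350 * 21 * 3 ^ 7)) := by
        have : (Finset.Icc (-7 : ℤ) 7).card = 15 := rfl
        rw [Finset.sum_const, this, nsmul_eq_mul, ENNReal.ofReal_mul (p := 15) (by norm_num)]
        norm_num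

set_option maxHeartbeats 1000000 in
/-- Localization of the error term. -/
lemma mem_thinSet_of_ne {t s x₁ x₂ y₁ y₂ θ₁ θ₂ : ℝ} (hs : 0 < s)
    (ht : 180 ≤ triScale s * t) (hsin : 0 ≤ Real.sin θ₁) (hy : (y₁, y₂) ∈ Yt t)
    (hempty : latimage (hmat x₁ x₂ y₁ y₂ θ₁ θ₂) ∩ calTs s = ∅)
    (hne : (Ltilde y₁ y₂ θ₁ θ₂ ∩ calTs s).Nonempty) :
    triScale s < 10 * (y₁ * y₂) ∧
      (y₁, y₂) ∈ thinSet (triScale s) (triWidth s θ₁) (octWidth s θ₂) := by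
  obtain ⟨hy₁, hy₂, hty, hq1, hq2⟩ := hy
  simp only at hy₁ hy₂ hty hq1 hq2
  have hR := triScale_pos hs
  have hl := lam_bounds
  have hl2 : lam ^ 2 < 6 := by nlinarith
  rcases lt_or_ge |Real.cos θ₁| (Real.sin θ₁) with hcs | hcs
  · refine absurd hempty (latimage_inter_ne_empty_of_abs_cos_lt hy₁ hy₂ hR hcs ?_)
    change 18 ≤ triScale s * _
    nlinarith
  obtain ⟨k, hk, hk'⟩ := (Ltilde_inter_nonempty_iff_unit hy₁ hy₂ hR hsin hcs).1 hne
  obtain ⟨hc0, hc⟩ := triWidth_bounds hs hsin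
  obtain ⟨hb0, hb⟩ := octWidth_bounds (θ := θ₂) hs
  obtain ⟨hcb, hcb'⟩ := le_triWidth_mul_octWidth (θ₂ := θ₂) hs hsin
  have slice : ∀ (k : ℤ) (τ₁ τ₂ : ℝ), lam ^ k * y₁ = τ₁ * triWidth s θ₁ →
      lam ^ (-k) * y₂ = τ₂ * octWidth s θ₂ → τ₁ < 1 → τ₂ < 1 →
      triScale s * (y₁ * y₂) * (min τ₁ (1 - τ₁) * (1 - τ₂)) < 18 :=
    fun k τ₁ τ₂ h1 h2 h3 h4 => slice_area_lt hy₁ hy₂ hR hsin hcs hempty h1 h2 h3 h4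
  change _ < triWidth s θ₁ at hk
  change _ < octWidth s θ₂ at hk'
  set c := triWidth s θ₁
  set b := octWidth s θ₂
  set R := triScale s
  have hyy : 0 < y₁ * y₂ := mul_pos hy₁ hy₂
  have hbig : c * b < 10 * (y₁ * y₂) := by
    by_contra! hcon
    obtain ⟨j, hj, hj'⟩ := exists_lam_zpow (x := c / (2 * y₁)) (by positivity)
    rw [zpow_add₀ lam_pos.ne', zpow_one] at hj'
    have hjp : 0 < lam ^ j := zpow_pos lam_pos j
    rw [le_div_iff₀ (by positivity)] at hj
    rw [div_lt_iff₀ (by positivity)] at hj'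
    have e1 : lam ^ j * y₁ / c ≤ 1 / 2 := by rw [div_le_iff₀ hc0]; linarith
    have e2 : 1 / 5 ≤ lam ^ j * y₁ / c := by
      rw [le_div_iff₀ hc0]; nlinarith [mul_pos hjp hy₁]
    have e3 : lam ^ (-j) * y₂ / b ≤ 1 / 2 := by
      rw [div_le_iff₀ hb0, _root_.zpow_neg, inv_mul_le_iff₀ hjp]
      by_contra! hcon2
      have g1 := mul_lt_mul_of_pos_right hj' hb0
      have g2 := mul_lt_mul_of_pos_left hcon2 hy₁
      nlinarith [mul_pos (mul_pos hjp hy₁) hb0]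
    have h := slice j _ _ (div_mul_cancel₀ _ hc0.ne').symm (div_mul_cancel₀ _ hb0.ne').symm
      (by linarith) (by linarith)
    have h5 : 1 / 5 ≤ min (lam ^ j * y₁ / c) (1 - lam ^ j * y₁ / c) :=
      le_min e2 (by linarith)
    have h6 : 1 / 5 * (1 / 2) ≤ min (lam ^ j * y₁ / c) (1 - lam ^ j * y₁ / c) *
        (1 - lam ^ (-j) * y₂ / b) := mul_le_mul h5 (by linarith) (by norm_num) (by linarith)
    have h7 : 180 ≤ R * (y₁ * y₂) := ht.trans (by gcongr)
    nlinarith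
  have hRy : R < 10 * (y₁ * y₂) := hcb.trans_lt hbig
  refine ⟨hRy, ?_⟩
  have hkp : 0 < lam ^ k := zpow_pos lam_pos k
  have hkk : lam ^ k * lam ^ (-k) = 1 := by
    rw [_root_.zpow_neg, mul_inv_cancel₀ hkp.ne']
  have hkn : 0 < lam ^ (-k) := zpow_pos lam_pos _
  have hsmall : y₁ * y₂ < c * b := by
    calc y₁ * y₂ = (lam ^ k * lam ^ (-k)) * (y₁ * y₂) := by rw [hkk, one_mul]
      _ = (lam ^ k * y₁) * (lam ^ (-k) * y₂) := by ring
      _ < c * b := by gcongr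
  have hr := Real.mul_self_sqrt hR.le
  set r := Real.sqrt R
  have hr0 : 0 < r := Real.sqrt_pos.2 hR
  rw [lt_div_iff₀ hy₂] at hq1
  rw [div_lt_iff₀ hy₂] at hq2
  have hq1' : y₂ < 6 * y₁ := by
    have : y₂ < lam ^ 2 * y₁ := by
      have e : lam ^ 2 * lam ^ (-2:ℤ) = 1 := by
        have := lam_pos.ne'
        rw [_root_.zpow_neg]; norm_cast; field_simp
      have : lam ^ 2 * (lam ^ (-2:ℤ) * y₂) < lam ^ 2 * y₁ := by
        have : 0 < lam ^ 2 := by nlinarith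
        gcongr
      rwa [← mul_assoc, e, one_mul] at this
    nlinarith
  have hq2' : y₁ < 6 * y₂ := by nlinarith
  have g1 := mul_lt_mul_of_pos_left hq1' hy₁
  have g2 := mul_lt_mul_of_pos_left hq2' hy₂
  have g3 := mul_lt_mul_of_pos_left hq1' hy₂
  have g4 := mul_lt_mul_of_pos_left hq2' hy₁
  have hy1u : y₁ ≤ 7 * r := by
    apply le_of_sq_le_sq _ (by positivity)
    have : (7 * r) ^ 2 = 49 * R := by rw [← hr]; ring
    linarith
  have hy2u : y₂ ≤ 7 * r := by
    apply le_of_sq_le_sq _ (by positivity)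
    have : (7 * r) ^ 2 = 49 * R := by rw [← hr]; ring
    linarith
  have hy1l : r ^ 2 < 60 * y₁ ^ 2 := by linarith
  have hy2l : r ^ 2 < 60 * y₂ ^ 2 := by linarith
  have hlam7 : (78125:ℝ) ≤ lam ^ 14 := by
    have : (5:ℝ) ≤ lam ^ 2 := by nlinarith
    calc (78125:ℝ) = 5 ^ 7 := by norm_num
      _ ≤ (lam ^ 2) ^ 7 := by gcongr
      _ = lam ^ 14 := by ring
  have hk7 : ∀ (j : ℤ) (y M : ℝ), 0 < y → lam ^ j * y ≤ M * r → M ≤ 17 → 0 ≤ M →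
      r ^ 2 < 60 * y ^ 2 → j ≤ 7 := by
    intro j y M hy h1 hM hM0 h2
    have hjp : 0 < lam ^ j := zpow_pos lam_pos j
    by_contra! hj
    have h3 : lam ^ 7 ≤ lam ^ j := by
      have := zpow_le_zpow_right₀ one_lt_lam.le hj.le
      exact_mod_cast this
    have h4 : lam ^ 7 * y ≤ 17 * r := by
      calc lam ^ 7 * y ≤ lam ^ j * y := by gcongr
        _ ≤ M * r := h1
        _ ≤ 17 * r := by gcongr
    have h5 : (lam ^ 7 * y) ^ 2 ≤ (17 * r) ^ 2 := by
      have := lam_pos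
      gcongr
    have h6 : (lam ^ 7 * y) ^ 2 = lam ^ 14 * y ^ 2 := by ring
    have : 0 < y ^ 2 := by positivity
    nlinarith
  have hk1 := hk7 k y₁ 17 hy₁ (hk.le.trans hc) le_rfl (by norm_num) hy1l
  have hk2 := hk7 (-k) y₂ 4 hy₂ (hk'.le.trans hb) (by norm_num) (by norm_num) hy2l
  have h1 : lam ^ k * y₁ / c < 1 := by rwa [div_lt_one hc0]
  have h2 : lam ^ (-k) * y₂ / b < 1 := by rwa [div_lt_one hb0]
  have h := slice k _ _ (div_mul_cancel₀ _ hc0.ne').symm (div_mul_cancel₀ _ hb0.ne').symm h1 h2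
  have h10 : 1 / 10 ≤ lam ^ k * y₁ / c := by
    rw [le_div_iff₀ hc0]
    apply le_of_mul_le_mul_right _ hb0
    have h8 : (lam ^ k * y₁) * (lam ^ (-k) * y₂) = y₁ * y₂ := by
      linear_combination (y₁ * y₂) * hkk
    have h9 : (lam ^ k * y₁) * (lam ^ (-k) * y₂) ≤ (lam ^ k * y₁) * b := by gcongr
    linarith
  have hI1 : y₁ ≤ c * lam ^ (-k) := by
    rw [_root_.zpow_neg, ← div_eq_mul_inv, le_div_iff₀ hkp]; linarith
  have hI2 : y₂ ≤ b * lam ^ k := by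
    rw [_root_.zpow_neg, inv_mul_lt_iff₀ hkp] at hk'; linarith
  have hthin : (1 - lam ^ k * y₁ / c) ≤ 50 / R ∨ (1 - lam ^ (-k) * y₂ / b) ≤ 50 / R := by
    by_contra! hcon
    obtain ⟨g1, g2⟩ := hcon
    rw [div_lt_iff₀ hR] at g1 g2
    have g3 : (1 - lam ^ k * y₁ / c) / 10 ≤ min (lam ^ k * y₁ / c) (1 - lam ^ k * y₁ / c) :=
      le_min (by linarith) (by linarith)
    have g4 : (1 - lam ^ k * y₁ / c) / 10 * (1 - lam ^ (-k) * y₂ / b) ≤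
        min (lam ^ k * y₁ / c) (1 - lam ^ k * y₁ / c) * (1 - lam ^ (-k) * y₂ / b) := by
      gcongr
    have g5 : R * (R / 10) * ((1 - lam ^ k * y₁ / c) / 10 * (1 - lam ^ (-k) * y₂ / b)) < 18 := by
      refine lt_of_le_of_lt ?_ h
      have : 0 ≤ (1 - lam ^ k * y₁ / c) / 10 * (1 - lam ^ (-k) * y₂ / b) :=
        mul_nonneg (by linarith) (by linarith)
      gcongr
      linarith
    have g6 : (50:ℝ) * 50 < ((1 - lam ^ k * y₁ / c) * R) * ((1 - lam ^ (-k) * y₂ / b) * R) := by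
      gcongr
    nlinarith
  refine mem_biUnion (x := k) (by simp; omega) ?_
  rcases hthin with g | g
  · refine Or.inl ⟨⟨?_, hI1⟩, hy₂.le, hy2u⟩
    have e : (1 - 50 / R) * c ≤ lam ^ k * y₁ := by
      rw [← le_div_iff₀ hc0]; linarith
    calc (1 - 50 / R) * (c * lam ^ (-k)) = (1 - 50 / R) * c * lam ^ (-k) := by ring
      _ ≤ (lam ^ k * y₁) * lam ^ (-k) := by gcongr
      _ = y₁ := by linear_combination y₁ * hkk
  · refine Or.inr ⟨⟨hy₁.le, hy1u⟩, ?_, hI2⟩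
    have e : (1 - 50 / R) * b ≤ lam ^ (-k) * y₂ := by
      rw [← le_div_iff₀ hb0]; linarith
    calc (1 - 50 / R) * (b * lam ^ k) = (1 - 50 / R) * b * lam ^ k := by ring
      _ ≤ (lam ^ (-k) * y₂) * lam ^ k := by gcongr
      _ = y₂ := by linear_combination y₂ * hkk

lemma volume_Fdom : volume Fdom = ENNReal.ofReal (2 * Real.sqrt 2) := by
  set M : Matrix (Fin 2) (Fin 2) ℝ := !![1, Real.sqrt 2; 1, -Real.sqrt 2] with hM
  set f := Matrix.toLin (Module.Basis.finTwoProd ℝ) (Module.Basis.finTwoProd ℝ) M with hf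
  have hdet : LinearMap.det f = -(2 * Real.sqrt 2) := by
    rw [hf, LinearMap.det_toLin, hM, Matrix.det_fin_two_of]; ring
  have himg : Fdom = (fun p => (1, 2) + p) '' (f '' (Ico 0 1 ×ˢ Ico 0 1)) := by
    ext p
    constructor
    · rintro ⟨a, ha, b, hb, rfl⟩
      refine ⟨_, ⟨(a, b), ⟨ha, hb⟩, rfl⟩, ?_⟩
      rw [hf, hM, Matrix.toLin_finTwoProd_apply]
      simp only [Prod.mk_add_mk, Prod.mk.injEq]
      constructor <;> ring
    · rintro ⟨_, ⟨⟨a, b⟩, ⟨ha, hb⟩, rfl⟩, rfl⟩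
      refine ⟨a, ha, b, hb, ?_⟩
      rw [hf, hM, Matrix.toLin_finTwoProd_apply]
      simp only [Prod.mk_add_mk, Prod.mk.injEq]
      constructor <;> ring
  rw [himg, image_add_left, measure_preimage_add, Measure.addHaar_image_linearMap, hdet,
    Measure.volume_eq_prod, Measure.prod_prod, Real.volume_Ico, abs_neg,
    abs_of_pos (by positivity)]
  norm_num

lemma volume_real_Fdom : volume.real Fdom = 2 * Real.sqrt 2 := by
  rw [Measure.real, volume_Fdom, ENNReal.toReal_ofReal (by positivity)]

lemma ind_nonneg (P : Prop) : 0 ≤ ind P := by unfold ind; split_ifs <;> norm_num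

lemma ind_le_one (P : Prop) : ind P ≤ 1 := by unfold ind; split_ifs <;> norm_num

lemma ind_of_true {P : Prop} (h : P) : ind P = 1 := if_pos h

lemma ind_of_false {P : Prop} (h : ¬P) : ind P = 0 := if_neg h

lemma measurableSet_Yt (t : ℝ) : MeasurableSet (Yt t) := by
  have h1 : Measurable fun y : ℝ × ℝ => y.1 / y.2 := by fun_prop
  have h2 : Measurable fun y : ℝ × ℝ => y.1 * y.2 := by fun_prop
  exact ((measurableSet_lt measurable_const measurable_fst).inter
    ((measurableSet_lt measurable_const measurable_snd).inter
    ((measurableSet_le measurable_const h2).inter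
    ((measurableSet_lt measurable_const h1).inter (measurableSet_lt h1 measurable_const)))))

lemma sin_nonneg_of_mem_Ico {θ : ℝ} (h : θ ∈ Ico 0 Real.pi) : 0 ≤ Real.sin θ :=
  Real.sin_nonneg_of_nonneg_of_le_pi h.1 h.2.le

lemma cH_pos : 0 < cH := by unfold cH; positivity

lemma integral_y_GE_le {t s θ₁ θ₂ : ℝ} (hs : 0 < s) (ht : 180 ≤ triScale s * t)
    (hθ₁ : θ₁ ∈ Ico 0 Real.pi) :
    ‖∫ y in Yt t, ∫ x in Fdom, (y.1 ^ 3 * y.2 ^ 3)⁻¹ *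
      ind (latimage (hmat x.1 x.2 y.1 y.2 θ₁ θ₂) ∩ calTs s = ∅ ∧
           (Ltilde y.1 y.2 θ₁ θ₂ ∩ calTs s).Nonempty)‖ ≤
    1000 / triScale s ^ 3 * (2 * Real.sqrt 2) * (15 * (350 * 21 * 3 ^ 7)) := by
  have hsin := sin_nonneg_of_mem_Ico hθ₁
  have hR := triScale_pos hs
  obtain ⟨hc0, hc⟩ := triWidth_bounds hs hsin
  obtain ⟨hb0, hb⟩ := octWidth_bounds (θ := θ₂) hs
  set E := thinSet (triScale s) (triWidth s θ₁) (octWidth s θ₂) with hE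
  have hEm : MeasurableSet E := measurableSet_thinSet _ _ _
  have hvol := volume_thinSet_le hR hc0 hb0 hc hb
  rw [← hE] at hvol
  set A := 1000 / triScale s ^ 3 * (2 * Real.sqrt 2) with hA
  have hA0 : 0 ≤ A := by positivity
  have hpt : ∀ y ∈ Yt t, ‖∫ x in Fdom, (y.1 ^ 3 * y.2 ^ 3)⁻¹ *
      ind (latimage (hmat x.1 x.2 y.1 y.2 θ₁ θ₂) ∩ calTs s = ∅ ∧
           (Ltilde y.1 y.2 θ₁ θ₂ ∩ calTs s).Nonempty)‖ ≤ E.indicator (fun _ => A) y := by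
    rintro ⟨y₁, y₂⟩ hy
    by_cases hex : ∃ x : ℝ × ℝ, latimage (hmat x.1 x.2 y₁ y₂ θ₁ θ₂) ∩ calTs s = ∅ ∧
           (Ltilde y₁ y₂ θ₁ θ₂ ∩ calTs s).Nonempty
    · obtain ⟨x, hx, hx'⟩ := hex
      obtain ⟨hbig, hmem⟩ := mem_thinSet_of_ne hs ht hsin hy hx hx'
      rw [indicator_of_mem hmem]
      have hyy : 0 < y₁ * y₂ := mul_pos hy.1 hy.2.1
      have hw : (y₁ ^ 3 * y₂ ^ 3)⁻¹ ≤ 1000 / triScale s ^ 3 := by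
        rw [← mul_pow, inv_le_comm₀ (by positivity) (by positivity), inv_div,
          div_le_iff₀ (by norm_num)]
        calc triScale s ^ 3 ≤ (10 * (y₁ * y₂)) ^ 3 := by gcongr
          _ = _ := by ring
      have := norm_setIntegral_le_of_norm_le_const (μ := volume) (s := Fdom)
        (C := 1000 / triScale s ^ 3)
        (f := fun x : ℝ × ℝ => (y₁ ^ 3 * y₂ ^ 3)⁻¹ *
          ind (latimage (hmat x.1 x.2 y₁ y₂ θ₁ θ₂) ∩ calTs s = ∅ ∧
           (Ltilde y₁ y₂ θ₁ θ₂ ∩ calTs s).Nonempty))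
        (by rw [volume_Fdom]; exact ENNReal.ofReal_lt_top) (by
          intro x _
          rw [norm_mul, Real.norm_of_nonneg (ind_nonneg _), Real.norm_of_nonneg
            (by rw [← mul_pow]; positivity)]
          exact (mul_le_of_le_one_right (by rw [← mul_pow]; positivity) (ind_le_one _)).trans hw)
      rwa [volume_real_Fdom] at this
    · push Not at hex
      have h0 : ∀ x : ℝ × ℝ, (y₁ ^ 3 * y₂ ^ 3)⁻¹ *
          ind (latimage (hmat x.1 x.2 y₁ y₂ θ₁ θ₂) ∩ calTs s = ∅ ∧
           (Ltilde y₁ y₂ θ₁ θ₂ ∩ calTs s).Nonempty) = 0 := by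
        intro x
        rw [ind_of_false, mul_zero]
        rintro ⟨h1, h2⟩
        exact h2.ne_empty (hex x h1)
      simp only [h0, integral_zero, norm_zero]
      exact indicator_nonneg (fun _ _ => hA0) _
  have hvol' : volume E < ⊤ := hvol.trans_lt ENNReal.ofReal_lt_top
  have hint : Integrable (E.indicator fun _ => A) (volume.restrict (Yt t)) := by
    apply Integrable.restrict
    exact (integrable_indicator_iff hEm).2 (integrableOn_const hvol'.ne)
  refine (norm_integral_le_of_norm_le hint
    ((ae_restrict_iff' (measurableSet_Yt t)).2 (Filter.Eventually.of_forall hpt))).trans ?_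
  rw [integral_indicator hEm, setIntegral_const, smul_eq_mul, mul_comm A]
  gcongr
  rw [Measure.real]
  apply ENNReal.toReal_le_of_le_ofReal (by norm_num)
  exact (Measure.restrict_apply_le _ _).trans hvol

/-- A power-saving bound for the error term. -/
lemma abs_GE_le {t s : ℝ} (hs : 0 < s) (ht : 180 ≤ triScale s * t) :
    |GE t s| ≤ cH * (1000 / triScale s ^ 3 * (2 * Real.sqrt 2) * (15 * (350 * 21 * 3 ^ 7)) *
      Real.pi * Real.pi) := by
  have hvol : (volume : Measure ℝ).real (Ico 0 Real.pi) = Real.pi := by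
    simp [Measure.real, Real.pi_pos.le]
  have hlt : (volume : Measure ℝ) (Ico 0 Real.pi) < ⊤ := measure_Ico_lt_top
  unfold GE
  rw [abs_mul, abs_of_pos cH_pos, ← Real.norm_eq_abs]
  gcongr
  · exact cH_pos.le
  refine (norm_setIntegral_le_of_norm_le_const hlt fun θ₂ _ =>
    norm_setIntegral_le_of_norm_le_const hlt fun θ₁ hθ₁ =>
      integral_y_GE_le hs ht hθ₁).trans_eq ?_
  rw [hvol]

/-- The part of the cone `λ⁻² < y₁/y₂ < λ²` lying outside all boxes `λᵏy₁ < c`, `λ⁻ᵏy₂ < b`. -/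
def coneSet (c b : ℝ) : Set (ℝ × ℝ) :=
  {y | 0 < y.1 ∧ 0 < y.2 ∧ lam ^ (-2:ℤ) < y.1 / y.2 ∧ y.1 / y.2 < lam ^ 2 ∧
    ∀ k : ℤ, c ≤ lam ^ k * y.1 ∨ b ≤ lam ^ (-k) * y.2}

/-- A fundamental domain, under the action of the units, for the complement of the boxes. -/
def coneBox (c b : ℝ) : Set (ℝ × ℝ) := Ici (c / lam) ×ˢ Ico b (b * lam)

/-- The action of the units on the plane. -/
def unitDil (j : ℤ) (y : ℝ × ℝ) : ℝ × ℝ := (lam ^ j * y.1, lam ^ (-j) * y.2)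

/-- The open cone `λ⁻² < y₁/y₂ < λ²`. -/
def unitCone : Set (ℝ × ℝ) :=
  {y | 0 < y.1 ∧ 0 < y.2 ∧ lam ^ (-2:ℤ) < y.1 / y.2 ∧ y.1 / y.2 < lam ^ 2}

lemma measurableSet_unitCone : MeasurableSet unitCone := by
  have h1 : Measurable fun y : ℝ × ℝ => y.1 / y.2 := by fun_prop
  exact ((measurableSet_lt measurable_const measurable_fst).inter
    ((measurableSet_lt measurable_const measurable_snd).inter
    ((measurableSet_lt measurable_const h1).inter (measurableSet_lt h1 measurable_const))))

lemma measurableSet_coneSet (c b : ℝ) : MeasurableSet (coneSet c b) := by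
  have h : coneSet c b =
      unitCone ∩ ⋂ k : ℤ, {y | c ≤ lam ^ k * y.1} ∪ {y | b ≤ lam ^ (-k) * y.2} := by
    ext y
    simp only [coneSet, unitCone, mem_inter_iff, mem_iInter, mem_union, Set.mem_ofPred_eq]
    tauto
  rw [h]
  refine measurableSet_unitCone.inter (MeasurableSet.iInter fun k =>
    (measurableSet_le measurable_const ?_).union (measurableSet_le measurable_const ?_)) <;>
  fun_prop

lemma measurePreserving_unitDil (j : ℤ) : MeasurePreserving (unitDil j) := by
  have hj : lam ^ j ≠ 0 := (zpow_pos lam_pos _).ne'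
  have hj' : lam ^ (-j) ≠ 0 := (zpow_pos lam_pos _).ne'
  refine ⟨by unfold unitDil; fun_prop, ?_⟩
  have h : unitDil j = Prod.map (lam ^ j * ·) (lam ^ (-j) * ·) := rfl
  rw [h, Measure.volume_eq_prod, ← Measure.map_prod_map _ _ (by fun_prop) (by fun_prop),
    Real.map_volume_mul_left hj, Real.map_volume_mul_left hj', Measure.prod_smul_left,
    Measure.prod_smul_right, smul_smul, ← ENNReal.ofReal_mul (abs_nonneg _), ← abs_mul,
    ← mul_inv, ← zpow_add₀ lam_pos.ne']
  simp

/-- The invariant weight `(y₁y₂)⁻³`. -/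
def cubeWeight (y : ℝ × ℝ) : ENNReal := ENNReal.ofReal ((y.1 ^ 3 * y.2 ^ 3)⁻¹)

lemma measurable_cubeWeight : Measurable cubeWeight := by unfold cubeWeight; fun_prop

lemma cubeWeight_unitDil (j : ℤ) (y : ℝ × ℝ) : cubeWeight (unitDil j y) = cubeWeight y := by
  have hj : lam ^ j ≠ 0 := (zpow_pos lam_pos _).ne'
  unfold cubeWeight unitDil
  rw [_root_.zpow_neg]
  congr 2
  field_simp

lemma exists_unitDil_mem_coneBox_iff {c b : ℝ} (hb : 0 < b) {y : ℝ × ℝ}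
    (hy₁ : 0 < y.1) (hy₂ : 0 < y.2) :
    (∃ j, unitDil j y ∈ coneBox c b) ↔ ∀ k : ℤ, c ≤ lam ^ k * y.1 ∨ b ≤ lam ^ (-k) * y.2 := by
  have hl := lam_pos
  have mono : ∀ {k j : ℤ}, k ≤ j → lam ^ k ≤ lam ^ j := fun h =>
    zpow_le_zpow_right₀ one_lt_lam.le h
  simp only [unitDil, coneBox, mem_prod, mem_Ici, mem_Ico]
  constructor
  · rintro ⟨j, h1, h2, h3⟩ k
    rcases le_or_gt k j with hk | hk
    · right
      exact h2.trans (mul_le_mul_of_nonneg_right (mono (by omega)) hy₂.le)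
    · left
      rw [div_le_iff₀ hl] at h1
      calc c ≤ lam ^ j * y.1 * lam := h1
        _ = lam ^ (j + 1) * y.1 := by rw [zpow_add_one₀ hl.ne']; ring
        _ ≤ _ := mul_le_mul_of_nonneg_right (mono (by omega)) hy₁.le
  · intro h
    obtain ⟨k, hk, hk'⟩ := exists_lam_zpow (div_pos hy₂ hb)
    have e : b ≤ lam ^ (-k) * y.2 := by
      rw [_root_.zpow_neg, ← div_eq_inv_mul, le_div_iff₀ (zpow_pos hl _)]
      rw [le_div_iff₀ hb] at hk
      linarith
    have e' : lam ^ (-k) * y.2 < b * lam := by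
      rw [_root_.zpow_neg, ← div_eq_inv_mul, div_lt_iff₀ (zpow_pos hl _)]
      rw [div_lt_iff₀ hb, zpow_add_one₀ hl.ne'] at hk'
      linarith
    refine ⟨k, ?_, e, e'⟩
    rw [div_le_iff₀ hl]
    rcases h (k + 1) with h | h
    · rw [zpow_add_one₀ hl.ne'] at h; linarith
    · exfalso
      rw [_root_.zpow_neg, zpow_add_one₀ hl.ne', mul_inv] at h
      rw [_root_.zpow_neg] at e'
      have h' : b * lam ≤ (lam ^ k)⁻¹ * lam⁻¹ * y.2 * lam := by gcongr
      rw [show (lam ^ k)⁻¹ * lam⁻¹ * y.2 * lam = (lam ^ k)⁻¹ * y.2 by field_simp] at h'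
      linarith

lemma unitDil_mem_coneBox_unique {c b : ℝ} (hb : 0 < b) {y : ℝ × ℝ} {i j : ℤ}
    (hi : unitDil i y ∈ coneBox c b) (hj : unitDil j y ∈ coneBox c b) : i = j := by
  have hl := lam_pos
  by_contra hne
  wlog hij : i < j generalizing i j
  · exact this hj hi (Ne.symm hne) (lt_of_le_of_ne (not_lt.1 hij) (Ne.symm hne))
  simp only [unitDil, coneBox, mem_prod, mem_Ici, mem_Ico] at hi hj
  have hy₂ : 0 < y.2 := by
    have := hb.trans_le hi.2.1
    exact (mul_pos_iff_of_pos_left (zpow_pos hl _)).1 this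
  have h1 : lam ^ (-j) * lam ≤ lam ^ (-i) := by
    rw [← zpow_add_one₀ hl.ne']
    exact zpow_le_zpow_right₀ one_lt_lam.le (by omega)
  have h2 : lam ^ (-j) * lam * y.2 ≤ lam ^ (-i) * y.2 := by gcongr
  have h3 : b * lam ≤ lam ^ (-j) * y.2 * lam := mul_le_mul_of_nonneg_right hj.2.1 hl.le
  linarith [hi.2.2]

lemma indicator_coneSet_eq_tsum {c b : ℝ} (hb : 0 < b) (y : ℝ × ℝ) :
    (coneSet c b).indicator cubeWeight y =
      ∑' j : ℤ, (unitCone ∩ unitDil j ⁻¹' coneBox c b).indicator cubeWeight y := by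
  by_cases hy : y ∈ coneSet c b
  · have ⟨h1, h2, h3, h4, h5⟩ := hy
    obtain ⟨j, hj⟩ := (exists_unitDil_mem_coneBox_iff hb h1 h2).2 h5
    rw [tsum_eq_single j, indicator_of_mem hy,
      indicator_of_mem (a := y) (s := unitCone ∩ unitDil j ⁻¹' coneBox c b) ⟨⟨h1, h2, h3, h4⟩, hj⟩]
    intro i hi
    exact indicator_of_notMem (fun h => hi (unitDil_mem_coneBox_unique hb h.2 hj)) _
  · rw [indicator_of_notMem hy]
    symm
    refine ENNReal.tsum_eq_zero.2 fun j => indicator_of_notMem (fun h => hy ?_) _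
    obtain ⟨⟨h1, h2, h3, h4⟩, h5⟩ := h
    exact ⟨h1, h2, h3, h4, (exists_unitDil_mem_coneBox_iff hb h1 h2).1 ⟨j, h5⟩⟩

lemma ae_ne_mul (a : ℝ) : ∀ᵐ y : ℝ × ℝ, y.1 ≠ a * y.2 := by
  set f : ℝ × ℝ →ₗ[ℝ] ℝ := LinearMap.fst ℝ ℝ ℝ - a • LinearMap.snd ℝ ℝ ℝ with hf
  have h : f.ker ≠ ⊤ := by
    intro h
    have : ((1, 0) : ℝ × ℝ) ∈ f.ker := h ▸ Submodule.mem_top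
    simp [hf] at this
  have := Measure.addHaar_submodule volume f.ker h
  rw [ae_iff]
  convert this using 2
  ext y
  simp [hf, sub_eq_zero]

/-- A generic orbit meets the cone in exactly two points. -/
lemma tsum_indicator_unitCone {z : ℝ × ℝ} (h₁ : 0 < z.1) (h₂ : 0 < z.2)
    (h : ∀ k : ℤ, z.1 ≠ lam ^ k * z.2) :
    ∑' j : ℤ, (unitDil (-j) ⁻¹' unitCone).indicator (fun _ => (1 : ENNReal)) z = 2 := by
  have hl := lam_pos
  have hmem : ∀ j : ℤ, z ∈ unitDil (-j) ⁻¹' unitCone ↔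
      lam ^ (2 * j - 2) < z.1 / z.2 ∧ z.1 / z.2 < lam ^ (2 * j + 2) := by
    intro j
    have hj : 0 < lam ^ j := zpow_pos hl _
    have e : lam ^ (-j) * z.1 / (lam ^ (- -j) * z.2) = z.1 / z.2 / lam ^ (2 * j) := by
      rw [neg_neg, _root_.zpow_neg, two_mul, zpow_add₀ hl.ne']; field_simp
    simp only [unitDil, unitCone, mem_preimage, Set.mem_ofPred_eq, e]
    rw [lt_div_iff₀ (zpow_pos hl _), div_lt_iff₀ (zpow_pos hl _), ← zpow_natCast,
      ← zpow_add₀ hl.ne', ← zpow_add₀ hl.ne']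
    have h3 : 0 < lam ^ (-j) * z.1 := mul_pos (zpow_pos hl _) h₁
    have h4 : 0 < lam ^ (- -j) * z.2 := mul_pos (zpow_pos hl _) h₂
    simp only [h3, h4, true_and]
    push_cast
    rw [show (-2 : ℤ) + 2 * j = 2 * j - 2 by ring, show (2 : ℤ) + 2 * j = 2 * j + 2 by ring]
  have hone : 1 < lam ^ 2 := one_lt_pow₀ one_lt_lam two_ne_zero
  obtain ⟨k, hk, hk'⟩ := exists_mem_Ico_zpow (div_pos h₁ h₂) hone
  rw [← zpow_natCast, ← _root_.zpow_mul] at hk hk'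
  push_cast at hk hk'
  have hk2 : lam ^ (2 * k) < z.1 / z.2 := by
    refine lt_of_le_of_ne hk fun h' => h (2 * k) ?_
    rw [h']; field_simp
  have lt : ∀ {m n : ℤ}, lam ^ m < lam ^ n ↔ m < n := zpow_lt_zpow_iff_right₀ one_lt_lam
  have hiff : ∀ j : ℤ, z ∈ unitDil (-j) ⁻¹' unitCone ↔ j ∈ ({k, k + 1} : Finset ℤ) := by
    intro j
    rw [hmem, Finset.mem_insert, Finset.mem_singleton]
    constructor
    · rintro ⟨h3, h4⟩
      have := lt.1 (h3.trans hk')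
      have := lt.1 (hk2.trans h4)
      omega
    · rintro (rfl | rfl)
      · exact ⟨(lt.2 (by omega)).trans hk2, hk'.trans_le (by rw [mul_add]; rfl)⟩
      · exact ⟨by rwa [show 2 * (k + 1) - 2 = 2 * k by ring], hk'.trans (lt.2 (by omega))⟩
  rw [tsum_eq_sum (s := {k, k + 1}) fun j hj => indicator_of_notMem (fun h' => hj ((hiff j).1 h')) _]
  rw [Finset.sum_congr rfl fun j hj => indicator_of_mem ((hiff j).2 hj) _]
  simp [one_add_one_eq_two]

lemma lintegral_Ici_inv_cube {a : ℝ} (ha : 0 < a) :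
    ∫⁻ x in Ici a, ENNReal.ofReal ((x ^ 3)⁻¹) = ENNReal.ofReal (1 / (2 * a ^ 2)) := by
  have h3 : (-3 : ℝ) < -1 := by norm_num
  have e : ∀ x ∈ Ioi a, x ^ (-3 : ℝ) = (x ^ 3)⁻¹ := fun x hx => by
    rw [Real.rpow_neg (ha.trans hx).le]; norm_cast
  have hi : IntegrableOn (fun x : ℝ => (x ^ 3)⁻¹) (Ioi a) :=
    (integrableOn_Ioi_rpow_of_lt h3 ha).congr_fun e measurableSet_Ioi
  rw [← setLIntegral_congr Ioi_ae_eq_Ici, ← ofReal_integral_eq_lintegral_ofReal hi,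
    ← setIntegral_congr_fun measurableSet_Ioi e, integral_Ioi_rpow_of_lt h3 ha]
  · congr 1
    rw [show (-3 : ℝ) + 1 = -2 by norm_num, Real.rpow_neg ha.le]
    norm_cast
    field_simp
    norm_num
  · refine (ae_restrict_iff' measurableSet_Ioi).2 (Filter.Eventually.of_forall fun x hx => ?_)
    have := ha.trans hx
    positivity

lemma lintegral_coneBox {c b : ℝ} (hc : 0 < c) (hb : 0 < b) :
    ∫⁻ z in coneBox c b, cubeWeight z = ENNReal.ofReal ((lam ^ 2 - 1) / (4 * c ^ 2 * b ^ 2)) := by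
  have hl := lam_pos
  have h1 := lintegral_Ici_inv_cube (div_pos hc hl)
  have hb' : ∫⁻ x in Ico b (b * lam), ENNReal.ofReal ((x ^ 3)⁻¹) =
      ENNReal.ofReal (1 / (2 * b ^ 2) - 1 / (2 * (b * lam) ^ 2)) := by
    have hle : b ≤ b * lam := le_mul_of_one_le_right hb.le one_lt_lam.le
    have hu := lintegral_union (μ := volume) (f := fun x : ℝ => ENNReal.ofReal ((x ^ 3)⁻¹))
      (measurableSet_Ici (a := b * lam)) (A := Ico b (b * lam))
      (Set.disjoint_left.2 fun x hx hx' => (not_lt.2 hx') hx.2)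
    rw [Ico_union_Ici_eq_Ici hle, lintegral_Ici_inv_cube hb,
      lintegral_Ici_inv_cube (mul_pos hb hl)] at hu
    rw [ENNReal.ofReal_sub _ (by positivity), hu, ENNReal.add_sub_cancel_right ENNReal.ofReal_ne_top]
  have hw : ∀ z ∈ coneBox c b, cubeWeight z =
      ENNReal.ofReal ((z.1 ^ 3)⁻¹) * ENNReal.ofReal ((z.2 ^ 3)⁻¹) := by
    rintro z ⟨hz, -⟩
    have := (div_pos hc hl).trans_le hz
    rw [cubeWeight, mul_inv, ENNReal.ofReal_mul (by positivity)]
  have hm : MeasurableSet (coneBox c b) := measurableSet_Ici.prod measurableSet_Ico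
  rw [setLIntegral_congr_fun hm hw, coneBox, Measure.volume_eq_prod, ← Measure.prod_restrict,
    lintegral_prod_mul (f := fun x : ℝ => ENNReal.ofReal ((x ^ 3)⁻¹))
      (g := fun x : ℝ => ENNReal.ofReal ((x ^ 3)⁻¹)) (by fun_prop) (by fun_prop), h1, hb',
    ← ENNReal.ofReal_mul (by positivity)]
  congr 1
  field_simp
  ring

lemma lintegral_coneSet {c b : ℝ} (hc : 0 < c) (hb : 0 < b) :
    ∫⁻ y in coneSet c b, cubeWeight y =
      ENNReal.ofReal ((lam ^ 2 - 1) / (2 * c ^ 2 * b ^ 2)) := by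
  have hm : MeasurableSet (coneBox c b) := measurableSet_Ici.prod measurableSet_Ico
  have hd := fun j => (measurePreserving_unitDil j).measurable
  have hg : ∀ j : ℤ, Measurable fun z => (coneBox c b).indicator cubeWeight z *
      (unitDil (-j) ⁻¹' unitCone).indicator (fun _ => (1 : ENNReal)) z := fun j =>
    (measurable_cubeWeight.indicator hm).mul
      (measurable_const.indicator (hd _ measurableSet_unitCone))
  have hbox : ∀ j : ℤ, ∫⁻ y, (unitCone ∩ unitDil j ⁻¹' coneBox c b).indicator cubeWeight y =
      ∫⁻ z, (coneBox c b).indicator cubeWeight z *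
        (unitDil (-j) ⁻¹' unitCone).indicator (fun _ => 1) z := by
    intro j
    rw [← (measurePreserving_unitDil j).lintegral_comp (hg j)]
    congr 1 with y
    have hinv : unitDil (-j) (unitDil j y) = y := by
      simp only [unitDil, ← mul_assoc, ← zpow_add₀ lam_pos.ne']
      simp
    classical
    simp only [indicator_apply, mem_inter_iff, mem_preimage, hinv, cubeWeight_unitDil]
    split_ifs <;> simp_all
  rw [← lintegral_indicator (measurableSet_coneSet c b)]
  simp only [indicator_coneSet_eq_tsum hb]
  rw [lintegral_tsum fun j => (measurable_cubeWeight.indicator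
    (measurableSet_unitCone.inter (hd j hm))).aemeasurable]
  simp only [hbox]
  rw [← lintegral_tsum fun j => (hg j).aemeasurable]
  simp only [ENNReal.tsum_mul_left]
  have hae : ∀ᵐ z : ℝ × ℝ, (coneBox c b).indicator cubeWeight z *
      ∑' j : ℤ, (unitDil (-j) ⁻¹' unitCone).indicator (fun _ => (1 : ENNReal)) z =
      (coneBox c b).indicator cubeWeight z * 2 := by
    filter_upwards [ae_all_iff.2 fun k : ℤ => ae_ne_mul (lam ^ k)] with z hz
    by_cases hzm : z ∈ coneBox c b
    · rw [tsum_indicator_unitCone ((div_pos hc lam_pos).trans_le hzm.1)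
        (hb.trans_le hzm.2.1) hz]
    · rw [indicator_of_notMem hzm, zero_mul, zero_mul]
  rw [lintegral_congr_ae hae, lintegral_mul_const _ (measurable_cubeWeight.indicator hm),
    lintegral_indicator hm, lintegral_coneBox hc hb, ← ENNReal.ofReal_ofNat 2,
    ← ENNReal.ofReal_mul (by
      have := one_lt_pow₀ one_lt_lam two_ne_zero
      exact div_nonneg (by linarith) (by positivity))]
  congr 1
  field_simp
  norm_num

lemma le_mul_of_mem_coneSet {c b : ℝ} (hc : 0 < c) (hb0 : 0 < b) {y : ℝ × ℝ}
    (hy : y ∈ coneSet c b) :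
    c * b ≤ 3 * (y.1 * y.2) := by
  obtain ⟨h1, h2, -, -, h⟩ := hy
  have hl := lam_pos
  obtain ⟨k, hk, hk'⟩ := exists_lam_zpow' (div_pos hc h1)
  have hp : 0 < lam ^ k := zpow_pos hl _
  rw [lt_div_iff₀ h1] at hk
  have hb := (h k).resolve_left (not_le.2 hk)
  rw [_root_.zpow_neg, ← div_eq_inv_mul, le_div_iff₀ hp] at hb
  rw [div_le_iff₀ h1, zpow_add_one₀ hl.ne'] at hk'
  calc c * b ≤ lam ^ k * lam * y.1 * b := by gcongr
    _ = lam * y.1 * (b * lam ^ k) := by ring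
    _ ≤ lam * y.1 * y.2 := by gcongr
    _ ≤ _ := by nlinarith [mul_pos h1 h2, lam_bounds.2]

/-- The `(x, y)`-integral of the main term. -/
lemma integral_y_GM_eq {t s θ₁ θ₂ : ℝ} (hs : 0 < s) (ht : 3 * t ≤ triScale s)
    (hsin : 0 ≤ Real.sin θ₁) :
    ∫ y in Yt t, ∫ _x in Fdom, (y.1 ^ 3 * y.2 ^ 3)⁻¹ *
      ind (Ltilde y.1 y.2 θ₁ θ₂ ∩ calTs s = ∅) =
    if Real.sin θ₁ ≤ |Real.cos θ₁| then
      2 * Real.sqrt 2 * ((lam ^ 2 - 1) / (2 * (triWidth s θ₁ * octWidth s θ₂) ^ 2)) else 0 := by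
  have hR : 0 < Real.sqrt (s / thetaHat) := triScale_pos hs
  split_ifs with h
  · set c := triWidth s θ₁ with hc
    set b := octWidth s θ₂ with hb
    have hc0 : 0 < c := (triWidth_bounds hs hsin).1
    have hb0 : 0 < b := (octWidth_bounds hs).1
    have hcb := (le_triWidth_mul_octWidth (θ₂ := θ₂) hs hsin).1
    have hsub : coneSet c b ⊆ Yt t := fun y hy => by
      have := le_mul_of_mem_coneSet hc0 hb0 hy
      exact ⟨hy.1, hy.2.1, by linarith, hy.2.2.1, hy.2.2.2.1⟩
    have hpt : ∀ y ∈ Yt t, ∫ _x in Fdom, (y.1 ^ 3 * y.2 ^ 3)⁻¹ *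
        ind (Ltilde y.1 y.2 θ₁ θ₂ ∩ calTs s = ∅) =
        (coneSet c b).indicator (fun y => 2 * Real.sqrt 2 * (y.1 ^ 3 * y.2 ^ 3)⁻¹) y := by
      intro y hy
      have hiff : Ltilde y.1 y.2 θ₁ θ₂ ∩ calTs s = ∅ ↔ y ∈ coneSet c b := by
        rw [← not_nonempty_iff_eq_empty,
          Ltilde_inter_nonempty_iff_unit hy.1 hy.2.1 hR hsin h]
        push Not
        constructor
        · intro hk
          refine ⟨hy.1, hy.2.1, hy.2.2.2.1, hy.2.2.2.2, fun k => ?_⟩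
          rcases le_or_gt c (lam ^ k * y.1) with h1 | h1
          · exact Or.inl h1
          · exact Or.inr (hk k h1)
        · intro hk k h1
          exact (hk.2.2.2.2 k).resolve_left (not_le.2 h1)
      rw [setIntegral_const, volume_real_Fdom, smul_eq_mul]
      by_cases hm : y ∈ coneSet c b
      · rw [indicator_of_mem hm, ind_of_true (hiff.2 hm), mul_one]
      · rw [indicator_of_notMem hm, ind_of_false (fun h' => hm (hiff.1 h')), mul_zero, mul_zero]
    rw [setIntegral_congr_fun (measurableSet_Yt t) hpt,
      setIntegral_indicator (measurableSet_coneSet c b), inter_eq_self_of_subset_right hsub,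
      integral_const_mul, integral_eq_lintegral_of_nonneg_ae]
    · have := lintegral_coneSet hc0 hb0
      unfold cubeWeight at this
      rw [this, ENNReal.toReal_ofReal, mul_pow, ← mul_assoc]
      have := one_lt_pow₀ one_lt_lam two_ne_zero
      exact div_nonneg (by linarith) (by positivity)
    · refine (ae_restrict_iff' (measurableSet_coneSet c b)).2
        (Filter.Eventually.of_forall fun y hy => ?_)
      have h1 := hy.1
      have h2 := hy.2.1
      positivity
    · fun_prop
  · have h0 : ∀ y : ℝ × ℝ, (y.1 ^ 3 * y.2 ^ 3)⁻¹ *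
        ind (Ltilde y.1 y.2 θ₁ θ₂ ∩ calTs s = ∅) = 0 := fun y => by
      rw [ind_of_false, mul_zero]
      exact (Ltilde_inter_nonempty_of_abs_cos_lt hR (not_le.1 h)).ne_empty
    simp only [h0, integral_zero]

lemma integral_inv_sq_cos_add_sin {p q α β : ℝ} (hp : p ≠ 0)
    (h : ∀ θ ∈ uIcc α β, p * Real.cos θ + q * Real.sin θ ≠ 0) :
    IntervalIntegrable (fun θ => ((p * Real.cos θ + q * Real.sin θ) ^ 2)⁻¹) volume α β ∧
    ∫ θ in α..β, ((p * Real.cos θ + q * Real.sin θ) ^ 2)⁻¹ =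
      Real.sin β / (p * (p * Real.cos β + q * Real.sin β)) -
        Real.sin α / (p * (p * Real.cos α + q * Real.sin α)) := by
  have hint : IntervalIntegrable (fun θ => ((p * Real.cos θ + q * Real.sin θ) ^ 2)⁻¹)
      volume α β :=
    ContinuousOn.intervalIntegrable
      (ContinuousOn.inv₀ (by fun_prop) fun θ hθ => pow_ne_zero 2 (h θ hθ))
  refine ⟨hint, ?_⟩
  refine intervalIntegral.integral_eq_sub_of_hasDerivAt
    (f := fun θ => Real.sin θ / (p * (p * Real.cos θ + q * Real.sin θ))) (fun θ hθ => ?_) hint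
  have hd : HasDerivAt (fun θ => p * (p * Real.cos θ + q * Real.sin θ))
      (p * (p * -Real.sin θ + q * Real.cos θ)) θ :=
    (((Real.hasDerivAt_cos θ).const_mul p).add ((Real.hasDerivAt_sin θ).const_mul q)).const_mul p
  have hne := h θ hθ
  refine ((Real.hasDerivAt_sin θ).div hd (mul_ne_zero hp hne)).congr_deriv ?_
  symm
  rw [eq_div_iff (pow_ne_zero 2 (mul_ne_zero hp hne)), mul_pow]
  have : ((p * Real.cos θ + q * Real.sin θ) ^ 2)⁻¹ *
      (p ^ 2 * (p * Real.cos θ + q * Real.sin θ) ^ 2) = p ^ 2 := by field_simp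
  rw [this]
  linear_combination (-p ^ 2) * Real.sin_sq_add_cos_sq θ

lemma integral_zero_pi_of_symm {f : ℝ → ℝ} (hf : ∀ θ, f (Real.pi - θ) = f θ)
    (hint : IntervalIntegrable f volume 0 (Real.pi / 2)) :
    ∫ θ in (0:ℝ)..Real.pi, f θ = 2 * ∫ θ in (0:ℝ)..(Real.pi / 2), f θ := by
  have h1 : IntervalIntegrable f volume (Real.pi / 2) Real.pi := by
    have := (hint.comp_sub_left Real.pi).symm
    simp only [hf, sub_zero] at this
    rwa [show Real.pi - Real.pi / 2 = Real.pi / 2 by ring] at this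
  have h2 : ∫ θ in (Real.pi / 2)..Real.pi, f θ = ∫ θ in (0:ℝ)..(Real.pi / 2), f θ := by
    have := intervalIntegral.integral_comp_sub_left (a := 0) (b := Real.pi / 2) f Real.pi
    simp only [hf, sub_zero] at this
    rw [this, show Real.pi - Real.pi / 2 = Real.pi / 2 by ring]
  rw [← intervalIntegral.integral_add_adjacent_intervals hint h1, h2, two_mul]

lemma setIntegral_Ico_pi (f : ℝ → ℝ) :
    ∫ θ in Ico (0:ℝ) Real.pi, f θ = ∫ θ in (0:ℝ)..Real.pi, f θ := by
  rw [intervalIntegral.integral_of_le Real.pi_pos.le, integral_Ico_eq_integral_Ioc]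

lemma cos_nonneg_of_le_pi_div_two {θ : ℝ} (h0 : 0 ≤ θ) (h1 : θ ≤ Real.pi / 2) :
    0 ≤ Real.cos θ := Real.cos_nonneg_of_neg_pi_div_two_le_of_le (by linarith [Real.pi_pos]) h1

lemma sin_nonneg_of_le_pi_div_two {θ : ℝ} (h0 : 0 ≤ θ) (h1 : θ ≤ Real.pi / 2) :
    0 ≤ Real.sin θ := Real.sin_nonneg_of_nonneg_of_le_pi h0 (by linarith [Real.pi_pos])

lemma sin_le_cos_of_le_pi_div_four {θ : ℝ} (h0 : 0 ≤ θ) (h1 : θ ≤ Real.pi / 4) :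
    Real.sin θ ≤ Real.cos θ := by
  rw [← Real.cos_pi_div_two_sub]
  exact Real.cos_le_cos_of_nonneg_of_le_pi h0 (by linarith [Real.pi_pos]) (by linarith)

lemma cos_lt_sin_of_pi_div_four_lt {θ : ℝ} (h0 : Real.pi / 4 < θ) (h1 : θ ≤ Real.pi / 2) :
    Real.cos θ < Real.sin θ := by
  rw [← Real.cos_pi_div_two_sub]
  exact Real.cos_lt_cos_of_nonneg_of_le_pi (by linarith) (by linarith [Real.pi_pos]) (by linarith)

lemma linear_cos_sin_pos {p q θ : ℝ} (hp : 0 < p) (hq : 0 < q) (h0 : 0 ≤ θ)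
    (h1 : θ ≤ Real.pi / 2) : 0 < p * Real.cos θ + q * Real.sin θ := by
  have hc := cos_nonneg_of_le_pi_div_two h0 h1
  have hs := sin_nonneg_of_le_pi_div_two h0 h1
  rcases hs.eq_or_lt with h | h
  · have := Real.sin_sq_add_cos_sq θ
    rw [← h] at this ⊢
    have hc' : 0 < Real.cos θ := by
      rcases hc.eq_or_lt with h' | h'
      · rw [← h'] at this; norm_num at this
      · exact h'
    positivity
  · positivity

lemma integral_triSupp :
    ∫ θ in Ico (0:ℝ) Real.pi,
      (if Real.sin θ ≤ |Real.cos θ| then (triSupp θ ^ 2)⁻¹ else 0) = 1 := by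
  have hpi := Real.pi_pos
  obtain ⟨hi, hv⟩ := integral_inv_sq_cos_add_sin (p := 1) (q := 1) (α := 0) (β := Real.pi / 4)
    one_ne_zero fun θ hθ => by
      rw [uIcc_of_le (by positivity)] at hθ
      exact (linear_cos_sin_pos one_pos one_pos hθ.1 (by linarith [hθ.2])).ne'
  set f : ℝ → ℝ := fun θ => if Real.sin θ ≤ |Real.cos θ| then (triSupp θ ^ 2)⁻¹ else 0 with hf
  have h1 : EqOn (fun θ => ((1 * Real.cos θ + 1 * Real.sin θ) ^ 2)⁻¹) f
      (uIcc 0 (Real.pi / 4)) := fun θ hθ => by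
    rw [uIcc_of_le (by positivity)] at hθ
    have hc := cos_nonneg_of_le_pi_div_two hθ.1 (by linarith [hθ.2])
    simp only [hf, triSupp, abs_of_nonneg hc, if_pos (sin_le_cos_of_le_pi_div_four hθ.1 hθ.2),
      one_mul]
  have h2 : EqOn (fun _ => 0) f (uIoc (Real.pi / 4) (Real.pi / 2)) := fun θ hθ => by
    rw [uIoc_of_le (by linarith)] at hθ
    have hc := cos_nonneg_of_le_pi_div_two (by linarith [hθ.1]) hθ.2
    simp only [hf, abs_of_nonneg hc, if_neg (not_le.2 (cos_lt_sin_of_pi_div_four_lt hθ.1 hθ.2))]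
  have hi1 : IntervalIntegrable f volume 0 (Real.pi / 4) :=
    hi.congr (h1.mono uIoc_subset_uIcc)
  have hi2 : IntervalIntegrable f volume (Real.pi / 4) (Real.pi / 2) :=
    (intervalIntegrable_const (c := (0:ℝ))).congr h2
  have e2 : ∫ θ in (Real.pi / 4)..(Real.pi / 2), f θ = 0 := by
    rw [intervalIntegral.integral_of_le (by linarith), ← uIoc_of_le (by linarith),
      ← setIntegral_congr_fun measurableSet_uIoc h2, integral_zero]
  rw [setIntegral_Ico_pi, integral_zero_pi_of_symm
    (fun θ => by simp only [hf, triSupp, Real.sin_pi_sub, Real.cos_pi_sub, abs_neg])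
    (hi1.trans hi2), ← intervalIntegral.integral_add_adjacent_intervals hi1 hi2, e2,
    ← intervalIntegral.integral_congr h1, hv, Real.sin_pi_div_four, Real.cos_pi_div_four]
  have := sqrt_two_bounds
  field_simp
  simp
  norm_num

lemma integral_octSupp :
    ∫ θ in Ico (0:ℝ) Real.pi, (octSupp θ ^ 2)⁻¹ = 8 / (lam * (lam + 1)) := by
  have hpi := Real.pi_pos
  have hl := lam_pos
  have hl1 := one_lt_lam
  have h2 : 0 < Real.sqrt 2 := by positivity
  obtain ⟨hi, hv⟩ := integral_inv_sq_cos_add_sin (p := lam) (q := 1) (α := 0) (β := Real.pi / 4)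
    hl.ne' fun θ hθ => by
      rw [uIcc_of_le (by positivity)] at hθ
      exact (linear_cos_sin_pos hl one_pos hθ.1 (by linarith [hθ.2])).ne'
  obtain ⟨hi', hv'⟩ := integral_inv_sq_cos_add_sin (p := 1) (q := lam) (α := Real.pi / 4)
    (β := Real.pi / 2) one_ne_zero fun θ hθ => by
      rw [uIcc_of_le (by linarith)] at hθ
      exact (linear_cos_sin_pos one_pos hl (by linarith [hθ.1]) hθ.2).ne'
  set f : ℝ → ℝ := fun θ => (octSupp θ ^ 2)⁻¹ with hf
  have h1 : EqOn (fun θ => 2 * ((lam * Real.cos θ + 1 * Real.sin θ) ^ 2)⁻¹) f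
      (uIcc 0 (Real.pi / 4)) := fun θ hθ => by
    rw [uIcc_of_le (by positivity)] at hθ
    have hc := cos_nonneg_of_le_pi_div_two hθ.1 (by linarith [hθ.2])
    have hs := sin_nonneg_of_le_pi_div_two hθ.1 (by linarith [hθ.2])
    have hsc := sin_le_cos_of_le_pi_div_four hθ.1 hθ.2
    simp only [hf, octSupp, abs_of_nonneg hc, abs_of_nonneg hs]
    rw [max_eq_left (by gcongr ?_ / _; nlinarith), div_pow, inv_div, Real.sq_sqrt (by norm_num),
      one_mul, div_eq_mul_inv]
  have h2 : EqOn (fun θ => 2 * ((1 * Real.cos θ + lam * Real.sin θ) ^ 2)⁻¹) f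
      (uIcc (Real.pi / 4) (Real.pi / 2)) := fun θ hθ => by
    rw [uIcc_of_le (by linarith)] at hθ
    have hc := cos_nonneg_of_le_pi_div_two (by linarith [hθ.1]) hθ.2
    have hs := sin_nonneg_of_le_pi_div_two (by linarith [hθ.1]) hθ.2
    have hsc : Real.cos θ ≤ Real.sin θ := by
      rcases hθ.1.eq_or_lt with h | h
      · rw [← h, Real.sin_pi_div_four, Real.cos_pi_div_four]
      · exact (cos_lt_sin_of_pi_div_four_lt h hθ.2).le
    simp only [hf, octSupp, abs_of_nonneg hc, abs_of_nonneg hs]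
    rw [max_eq_right (by gcongr ?_ / _; nlinarith), div_pow, inv_div, Real.sq_sqrt (by norm_num),
      one_mul, div_eq_mul_inv]
  have hi1 : IntervalIntegrable f volume 0 (Real.pi / 4) :=
    (hi.const_mul 2).congr (h1.mono uIoc_subset_uIcc)
  have hi2 : IntervalIntegrable f volume (Real.pi / 4) (Real.pi / 2) :=
    (hi'.const_mul 2).congr (h2.mono uIoc_subset_uIcc)
  rw [setIntegral_Ico_pi, integral_zero_pi_of_symm
    (fun θ => by simp only [hf, octSupp, Real.sin_pi_sub, Real.cos_pi_sub, abs_neg])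
    (hi1.trans hi2), ← intervalIntegral.integral_add_adjacent_intervals hi1 hi2,
    ← intervalIntegral.integral_congr h1, ← intervalIntegral.integral_congr h2,
    intervalIntegral.integral_const_mul, intervalIntegral.integral_const_mul, hv, hv',
    Real.sin_pi_div_four, Real.cos_pi_div_four, Real.sin_pi_div_two, Real.cos_pi_div_two,
    Real.sin_zero]
  have hl2 : 1 + lam ≠ 0 := by positivity
  field_simp
  ring

/-- The main term is exactly `C_𝒫 / s` for large `s`. -/
lemma GM_eq {t s : ℝ} (hs : 0 < s) (ht : 3 * t ≤ triScale s) : GM t s = CP / s := by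
  have hR := triScale_pos hs
  have hpi := Real.pi_pos
  set A := 2 * Real.sqrt 2 * ((lam ^ 2 - 1) / (2 * triScale s ^ 2)) with hA
  have h1 : ∀ θ₂ : ℝ, ∫ θ₁ in Ico (0:ℝ) Real.pi, ∫ y in Yt t, ∫ _x in Fdom,
      (y.1 ^ 3 * y.2 ^ 3)⁻¹ * ind (Ltilde y.1 y.2 θ₁ θ₂ ∩ calTs s = ∅) =
      A * (octSupp θ₂ ^ 2)⁻¹ := by
    intro θ₂
    have e : ∀ θ₁ ∈ Ico (0:ℝ) Real.pi, ∫ y in Yt t, ∫ _x in Fdom,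
      (y.1 ^ 3 * y.2 ^ 3)⁻¹ * ind (Ltilde y.1 y.2 θ₁ θ₂ ∩ calTs s = ∅) =
      A * (octSupp θ₂ ^ 2)⁻¹ *
        (if Real.sin θ₁ ≤ |Real.cos θ₁| then (triSupp θ₁ ^ 2)⁻¹ else 0) := by
      intro θ₁ hθ
      rw [integral_y_GM_eq hs ht (sin_nonneg_of_mem_Ico hθ), triWidth_mul_octWidth, hA]
      split_ifs
      · simp only [mul_pow, div_eq_mul_inv, mul_inv]; ring
      · rw [mul_zero]
    rw [setIntegral_congr_fun measurableSet_Ico e, integral_const_mul, integral_triSupp, mul_one]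
  have hsq : triScale s ^ 2 = s / thetaHat :=
    Real.sq_sqrt (div_nonneg hs.le (by linarith [thetaHat_bounds.1]))
  unfold GM
  simp only [h1]
  rw [integral_const_mul, integral_octSupp, hA, hsq, lam_sq, cH, thetaHat, CP]
  have hl := lam_pos
  have h2 := sqrt_two_sq
  have h2p : 0 < Real.sqrt 2 := by positivity
  have hlam : lam + 1 = 2 + Real.sqrt 2 := by unfold lam; ring
  rw [hlam]
  have hne : 2 + Real.sqrt 2 ≠ 0 := by positivity
  field_simp
  ring_nf
  linear_combination (4608 * lam) * h2

lemma rpow_le_triScale_cube {s : ℝ} (hs : 1 ≤ s) :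
    s ^ ((9:ℝ)/8) ≤ triScale s ^ 3 := by
  have h := (sqrt_le_sqrt_div_thetaHat (by linarith : 0 < s)).1
  calc s ^ ((9:ℝ)/8) ≤ s ^ ((3:ℝ)/2) := Real.rpow_le_rpow_of_exponent_le hs (by norm_num)
    _ = Real.sqrt s ^ 3 := by
      rw [Real.sqrt_eq_rpow, ← Real.rpow_natCast, ← Real.rpow_mul (by linarith)]; norm_num
    _ ≤ _ := pow_le_pow_left₀ (Real.sqrt_nonneg _) h 3

theorem stmt8 : ∀ t > (0:ℝ), ∃ C > (0:ℝ), ∃ s₀ > (0:ℝ), ∀ s ≥ s₀,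
    GE t s ≤ C * s ^ (-(9:ℝ)/8) ∧
    |GM t s + GE t s - CP / s| ≤ C * s ^ (-(9:ℝ)/8) := by
  intro t ht
  set B := cH * (1000 * (2 * Real.sqrt 2) * (15 * (350 * 21 * 3 ^ 7)) * Real.pi * Real.pi) with hB
  have hBpos : 0 < B := by have := cH_pos; positivity
  set R := max (180 / t) (3 * t) with hR
  have hRpos : 0 < R := lt_max_of_lt_right (by positivity)
  refine ⟨B, hBpos, max 1 (R ^ 2), by positivity, fun s hs => ?_⟩
  have hs1 : 1 ≤ s := (le_max_left _ _).trans hs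
  have hs0 : 0 < s := by linarith
  have hRs : R ≤ triScale s :=
    (Real.le_sqrt' hRpos |>.2 ((le_max_right _ _).trans hs)).trans
      (sqrt_le_sqrt_div_thetaHat hs0).1
  have h180 : 180 ≤ triScale s * t := by
    rw [← div_le_iff₀ ht]
    exact (le_max_left _ _).trans hRs
  have hE : |GE t s| ≤ B * s ^ (-(9:ℝ)/8) := by
    refine (abs_GE_le hs0 h180).trans ?_
    have hT := rpow_le_triScale_cube hs1
    have hp : 0 < s ^ ((9:ℝ)/8) := Real.rpow_pos_of_pos hs0 _
    rw [neg_div, Real.rpow_neg hs0.le]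
    calc _ = B * (triScale s ^ 3)⁻¹ := by rw [hB]; ring
      _ ≤ _ := by gcongr
  refine ⟨(le_abs_self _).trans hE, ?_⟩
  rwa [GM_eq hs0 ((le_max_right _ _).trans hRs), add_sub_cancel_left]

end
end

section
/- Let ℓ ∈ ℤ[√2] ∖ {0}, let z₁ > 0 and z₂ ∈ ℝ with |z₂| < z₁, let w = (w₁,w₂) ∈ 𝒲, and let h ∈ H satisfy (0, ℓ, 0, σ(ℓ))·h = (z₁, z₂, w₁, w₂). If ℓ is not a unit of ℤ[√2], or if w ∈ (√2−1)·𝒲, then 𝓛h ∩ (T(z₁²·θ̂) × 𝒲) ≠ ∅. -/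
open MeasureTheory Matrix Set Pointwise

noncomputable section

lemma emb_mul_embc (α : Zsqrtd 2) : emb α * embc α = (α.norm : ℝ) := by
  have h2 : Real.sqrt 2 * Real.sqrt 2 = 2 := Real.mul_self_sqrt (by norm_num)
  simp only [emb, embc, Zsqrtd.norm_def]
  push_cast
  linear_combination (-(α.im : ℝ) * α.im) * h2

lemma lam_inv : lam⁻¹ = Real.sqrt 2 - 1 := by
  have h2 : Real.sqrt 2 * Real.sqrt 2 = 2 := Real.mul_self_sqrt (by norm_num)
  refine inv_eq_of_mul_eq_one_right ?_
  unfold lam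
  linear_combination h2

lemma emb_lam_inv : emb ⟨-1, 1⟩ = lam⁻¹ := by
  rw [lam_inv]
  simp only [emb]
  push_cast
  ring

lemma embc_lam_inv : embc ⟨-1, 1⟩ = -lam := by
  simp only [embc, lam]
  push_cast
  ring

/-- Every integral power of `λ` is the real embedding of some `u`, with `|σ(u)|` its inverse. -/
lemma exists_emb_eq_lam_zpow (n : ℤ) :
    ∃ u : Zsqrtd 2, emb u = lam ^ n ∧ |embc u| = (lam ^ n)⁻¹ := by
  have hl := lam_pos
  have hi := lam_inv
  induction n with
  | zero => exact ⟨1, by simp [emb], by simp [embc]⟩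
  | succ n ih =>
    obtain ⟨u, hu, hu'⟩ := ih
    refine ⟨u * ⟨1, 1⟩, ?_, ?_⟩
    · rw [emb_mul, hu, zpow_add_one₀ hl.ne']
      simp [emb, lam]
    · have h1 : |embc ⟨1, 1⟩| = lam⁻¹ := by
        rw [← abs_of_pos (inv_pos.2 hl), hi, abs_sub_comm]
        simp [embc]
      rw [embc_mul, abs_mul, hu', h1, zpow_add_one₀ hl.ne', mul_inv]
  | pred n ih =>
    obtain ⟨u, hu, hu'⟩ := ih
    refine ⟨u * ⟨-1, 1⟩, ?_, ?_⟩
    · rw [emb_mul, hu, zpow_sub_one₀ hl.ne', emb_lam_inv]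
    · rw [embc_mul, abs_mul, hu', embc_lam_inv, abs_neg, abs_of_pos hl, zpow_sub_one₀ hl.ne', mul_inv, inv_inv]

/-- A nonzero nonunit of `ℤ[√2]` strictly dominates some element, nonzero in the first embedding,
in both embeddings. -/
lemma exists_emb_lt_of_not_isUnit {ℓ : Zsqrtd 2} (hℓ : ℓ ≠ 0) (hu : ¬ IsUnit ℓ) :
    ∃ β : Zsqrtd 2, emb β ≠ 0 ∧ |emb β| < |emb ℓ| ∧ |embc β| < |embc ℓ| := by
  have hnorm := emb_mul_embc ℓ
  have hn0 : ℓ.norm ≠ 0 := fun h0 =>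
    hℓ ((Zsqrtd.norm_eq_zero (fun n hn => by
      have h1 : n.natAbs * n.natAbs = 2 := by rw [← Int.natAbs_mul, ← hn]; rfl
      have h2 : n.natAbs < 2 := by nlinarith
      interval_cases n.natAbs <;> omega) ℓ).1 h0)
  have hn1 : ℓ.norm.natAbs ≠ 1 := fun h1 => hu (Zsqrtd.norm_eq_one_iff.1 h1)
  have hne : emb ℓ * embc ℓ ≠ 0 := by rw [hnorm]; exact_mod_cast hn0
  have he : 0 < |emb ℓ| := abs_pos.2 (left_ne_zero_of_mul hne)
  have hc : 0 < |embc ℓ| := abs_pos.2 (right_ne_zero_of_mul hne)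
  have hs2 : 1 < Real.sqrt 2 := by rw [Real.lt_sqrt] <;> norm_num
  have hs2' : Real.sqrt 2 < 2 := by rw [Real.sqrt_lt'] <;> norm_num
  by_cases hN : ℓ.norm.natAbs = 2
  · have heven : (2 : ℤ) ∣ ℓ.re := by
      have h2 : (2 : ℤ) ∣ ℓ.norm := by omega
      rw [Zsqrtd.norm_def] at h2
      have h3 : (2 : ℤ) ∣ ℓ.re * ℓ.re := by
        rw [mul_assoc] at h2
        exact (dvd_sub_left (Dvd.intro _ rfl)).1 h2
      exact (or_self_iff.1 (Int.prime_two.dvd_or_dvd h3))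
    obtain ⟨k, hk⟩ := heven
    have hfac : ℓ = ⟨ℓ.im, k⟩ * ⟨0, 1⟩ := by
      ext <;> simp [hk, mul_comm]
    set β : Zsqrtd 2 := ⟨ℓ.im, k⟩
    have h1 : emb ℓ = emb β * Real.sqrt 2 := by rw [hfac, emb_mul]; simp [emb]
    have h2 : embc ℓ = embc β * -Real.sqrt 2 := by rw [hfac, embc_mul]; simp [embc]
    rw [h1, abs_mul, abs_of_pos (by positivity : 0 < Real.sqrt 2)] at he
    rw [h2, abs_mul, abs_neg, abs_of_pos (by positivity : 0 < Real.sqrt 2)] at hc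
    have he' := pos_of_mul_pos_left he (by positivity)
    have hc' := pos_of_mul_pos_left hc (by positivity)
    refine ⟨β, abs_pos.1 he', ?_, ?_⟩
    · rw [h1, abs_mul, abs_of_pos (by positivity : 0 < Real.sqrt 2)]
      nlinarith
    · rw [h2, abs_mul, abs_neg, abs_of_pos (by positivity : 0 < Real.sqrt 2)]
      nlinarith
  · have h3 : 3 ≤ |emb ℓ| * |embc ℓ| := by
      rw [← abs_mul, hnorm]
      have : (3 : ℤ) ≤ |ℓ.norm| := by rw [Int.abs_eq_natAbs]; omega
      exact_mod_cast this
    have hlam : 1 < lam ∧ lam < 3 := by unfold lam; constructor <;> linarith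
    obtain ⟨n, hn, hn'⟩ := exists_mem_Ioc_zpow he hlam.1
    obtain ⟨u, hu1, hu2⟩ := exists_emb_eq_lam_zpow n
    have hp : 0 < lam ^ n := zpow_pos lam_pos n
    refine ⟨u, hu1 ▸ hp.ne', by rwa [hu1, abs_of_pos hp], ?_⟩
    rw [zpow_add_one₀ lam_pos.ne'] at hn'
    rw [hu2, inv_lt_iff_one_lt_mul₀ hp]
    have h4 : |emb ℓ| * |embc ℓ| ≤ lam ^ n * lam * |embc ℓ| := by gcongr
    have h5 : lam ^ n * |embc ℓ| * lam < lam ^ n * |embc ℓ| * 3 := by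
      gcongr
      exact hlam.2
    linarith

lemma Woct_smul_mem {w : ℝ × ℝ} (hw : w ∈ Woct) {d : ℝ} (hd : |d| ≤ 1) :
    (d * w.1, d * w.2) ∈ Woct := by
  obtain ⟨h1, h2, h3⟩ := hw
  have e1 : |d * w.1| ≤ |w.1| := by
    rw [abs_mul]; exact mul_le_of_le_one_left (abs_nonneg _) hd
  have e2 : |d * w.2| ≤ |w.2| := by
    rw [abs_mul]; exact mul_le_of_le_one_left (abs_nonneg _) hd
  exact ⟨e1.trans_lt h1, e2.trans_lt h2, (add_le_add e1 e2).trans_lt h3⟩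

lemma vecMul_bd (a b c d : ℝ) (A B : Matrix (Fin 2) (Fin 2) ℝ) :
    Matrix.vecMul ![a, b, c, d] (bd A B) =
      ![a * A 0 0 + b * A 1 0, a * A 0 1 + b * A 1 1,
        c * B 0 0 + d * B 1 0, c * B 0 1 + d * B 1 1] := by
  ext i
  fin_cases i <;> simp [Matrix.vecMul, dotProduct, Fin.sum_univ_four, bd]

/-- A multiple `(cz, dw)` of the given lattice vector lies in `T × 𝒲` as soon as `0 < c < 1`
and `dw ∈ 𝒲`. -/
lemma latimage_inter_Tprime_nonempty {ℓ β : Zsqrtd 2} {z₁ z₂ c d : ℝ} (hz₁ : 0 < z₁)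
    (hz₂ : |z₂| < z₁) {w : ℝ × ℝ} {h : Matrix (Fin 4) (Fin 4) ℝ} (hH : h ∈ Hset)
    (heq : Matrix.vecMul ![0, emb ℓ, 0, embc ℓ] h = ![z₁, z₂, w.1, w.2])
    (hβ : emb β = c * emb ℓ) (hβ' : embc β = d * embc ℓ) (hc₀ : 0 < c) (hc₁ : c < 1)
    (hd : (d * w.1, d * w.2) ∈ Woct) :
    (latimage h ∩ Tprime (z₁ ^ 2 * thetaHat)).Nonempty := by
  obtain ⟨A, B, -, -, rfl⟩ := hH
  have hv : Matrix.vecMul (latvec 0 β) (bd A B) = ![c * z₁, c * z₂, d * w.1, d * w.2] := by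
    rw [vecMul_bd] at heq
    have e0 := congrFun heq 0
    have e1 := congrFun heq 1
    have e2 := congrFun heq 2
    have e3 := congrFun heq 3
    simp at e0 e1 e2 e3
    rw [latvec, vecMul_bd, hβ, hβ', ← e0, ← e1, ← e2, ← e3]
    simp [emb, embc, mul_assoc]
  have hθ : thetaHat ≠ 0 := by unfold thetaHat; positivity
  refine ⟨_, ⟨latvec 0 β, ⟨0, β, rfl⟩, hv⟩, ⟨?_, ?_, ?_⟩, hd⟩
  · exact mul_pos hc₀ hz₁
  · change c * z₁ < Real.sqrt (z₁ ^ 2 * thetaHat / thetaHat)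
    rw [mul_div_cancel_right₀ _ hθ, Real.sqrt_sq hz₁.le]
    exact mul_lt_of_lt_one_left hz₁ hc₁
  · change |c * z₂| < c * z₁
    rw [abs_mul, abs_of_pos hc₀]
    gcongr

theorem stmt9 (ℓ : Zsqrtd 2) (hℓ : ℓ ≠ 0) (z₁ z₂ : ℝ) (hz₁ : 0 < z₁) (hz₂ : |z₂| < z₁)
    (w : ℝ × ℝ) (hw : w ∈ Woct) (h : Matrix (Fin 4) (Fin 4) ℝ) (hH : h ∈ Hset)
    (heq : Matrix.vecMul ![0, emb ℓ, 0, embc ℓ] h = ![z₁, z₂, w.1, w.2])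
    (hcase : ¬ IsUnit ℓ ∨ w ∈ (Real.sqrt 2 - 1) • Woct) :
    (latimage h ∩ Tprime (z₁ ^ 2 * thetaHat)).Nonempty := by
  rcases hcase with hu | hw'
  · obtain ⟨β, hβ0, hβ, hβ'⟩ := exists_emb_lt_of_not_isUnit hℓ hu
    wlog hpos : 0 < emb β / emb ℓ generalizing β
    · have hne : emb β / emb ℓ ≠ 0 :=
        div_ne_zero hβ0 (abs_pos.1 ((abs_nonneg _).trans_lt hβ))
      have hneg := lt_of_le_of_ne (not_lt.1 hpos) hne
      refine this (-β) ?_ ?_ ?_ ?_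
      · rwa [emb_neg, neg_ne_zero]
      · rwa [emb_neg, abs_neg]
      · rwa [embc_neg, abs_neg]
      · rw [emb_neg, neg_div]
        linarith
    have hℓe := (abs_nonneg _).trans_lt hβ
    have hℓc := (abs_nonneg _).trans_lt hβ'
    refine latimage_inter_Tprime_nonempty hz₁ hz₂ hH heq
      (div_mul_cancel₀ _ (abs_pos.1 hℓe)).symm (div_mul_cancel₀ _ (abs_pos.1 hℓc)).symm
      hpos ?_ (Woct_smul_mem hw ?_)
    · rw [← abs_of_pos hpos, abs_div, div_lt_one hℓe]
      exact hβ
    · rw [abs_div, div_le_one hℓc]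
      exact hβ'.le
  · obtain ⟨v, hv, rfl⟩ := hw'
    have hmul : lam * (Real.sqrt 2 - 1) = 1 := by
      rw [← lam_inv, mul_inv_cancel₀ lam_pos.ne']
    have hs2 : 1 < Real.sqrt 2 := by rw [Real.lt_sqrt] <;> norm_num
    have hs2' : Real.sqrt 2 < 2 := by rw [Real.sqrt_lt'] <;> norm_num
    refine latimage_inter_Tprime_nonempty (β := ⟨-1, 1⟩ * ℓ) (c := Real.sqrt 2 - 1) (d := -lam)
      hz₁ hz₂ hH heq ?_ ?_ (by linarith) (by linarith) ?_
    · rw [emb_mul, emb_lam_inv, lam_inv]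
    · rw [embc_mul, embc_lam_inv]
    · convert Woct_smul_mem hv (d := -1) (by simp) using 2
      · simp only [Prod.smul_fst, smul_eq_mul]
        linear_combination -v.1 * hmul
      · simp only [Prod.smul_snd, smul_eq_mul]
        linear_combination -v.2 * hmul

end
end
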